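/- arXiv:0901.4176 — 3 statements merged into one kernel-verified Lean document; each statement's English description precedes it below -/
import Mathlib

section
/- (Selberg integral, ordered form.) Let k ≥ 1 be an integer and let α, β, γ be complex numbers with Re(α) > 0, Re(β) > 0, γ ≠ 0, and Re(γ) > −min{1/k, Re(α)/(k−1), Re(β)/(k−1)} (for k = 1 the last two constraints are omitted, i.e. only Re(γ) > −1 is required). Then the integral over the set {(t_1,…,t_k) ∈ ℝ^k : 0 < t_1 < … < t_k < 1} of ∏_{i=1}^k t_i^{α−1} (1−t_i)^{β−1} · ∏_{1≤i<j≤k} |t_i−t_j|^{2γ} converges absolutely and equals ∏_{i=0}^{k−1} [Γ(α+iγ) Γ(β+iγ) Γ((i+1)γ)] / [Γ(α+β+(i+k−1)γ) Γ(γ)]. -/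
open MeasureTheory

/-- The open ordered simplex `{0 < t_1 < … < t_k < 1} ⊂ ℝ^k`. -/
def orderedSimplex (k : ℕ) : Set (Fin k → ℝ) :=
  {t | StrictMono t ∧ ∀ i, 0 < t i ∧ t i < 1}

/-- The Selberg integrand `∏ t_i^{α−1}(1−t_i)^{β−1} ∏_{i<j} |t_i−t_j|^{2γ}`,
where powers of positive reals are taken via `x^z = exp(z log x)` (complex power). -/
noncomputable def selbergIntegrand (k : ℕ) (α β γ : ℂ) (t : Fin k → ℝ) : ℂ :=
  (∏ i : Fin k, ((t i : ℂ) ^ (α - 1) * ((1 - t i : ℝ) : ℂ) ^ (β - 1))) *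
    ∏ p ∈ Finset.univ.filter (fun p : Fin k × Fin k => p.1 < p.2),
      ((|t p.1 - t p.2| : ℝ) : ℂ) ^ (2 * γ)

/-- The Vandermonde product `∏_{i<j} (t_j - t_i)`. -/
def diffProd {n : ℕ} (t : Fin n → ℝ) : ℝ :=
  ∏ i, ∏ j ∈ Finset.Ioi i, (t j - t i)

/-- The product `∏_{i ≠ j} |x_j - x_i|` of the distances from the node `x_j` to the others. -/
def nodeProd {n : ℕ} (x : Fin n → ℝ) (j : Fin n) : ℝ :=
  ∏ i ∈ Finset.univ.erase j, |x j - x i|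

lemma diffProd_succ {n : ℕ} (t : Fin (n + 1) → ℝ) :
    diffProd t = (∏ j : Fin n, (t j.succ - t 0)) * diffProd (fun i => t i.succ) := by
  simp only [diffProd, Fin.prod_univ_succ (n := n), Fin.prod_Ioi_zero, Fin.prod_Ioi_succ]

lemma diffProd_castSucc {n : ℕ} (t : Fin (n + 1) → ℝ) :
    diffProd t = diffProd (fun i : Fin n => t i.castSucc) *
      ∏ i : Fin n, (t (Fin.last n) - t i.castSucc) := by
  induction n with
  | zero => simp [diffProd]
  | succ n ih =>
    rw [diffProd_succ, ih, diffProd_succ (fun i : Fin (n + 1) => t i.castSucc),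
      Fin.prod_univ_castSucc, Fin.prod_univ_succ (n := n) (f := fun i => t _ - t (Fin.castSucc i))]
    simp only [Fin.succ_last, Fin.succ_castSucc, Fin.castSucc_zero]
    ring

lemma nodeProd_eq_ite {n : ℕ} (x : Fin n → ℝ) (j : Fin n) :
    nodeProd x j = ∏ i, if i = j then 1 else |x j - x i| := by
  rw [nodeProd, ← Finset.mul_prod_erase Finset.univ _ (Finset.mem_univ j), if_pos rfl, one_mul]
  exact Finset.prod_congr rfl fun i hi => (if_neg (Finset.ne_of_mem_erase hi)).symm

lemma nodeProd_zero {n : ℕ} (x : Fin (n + 1) → ℝ) :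
    nodeProd x 0 = ∏ i : Fin n, |x 0 - x i.succ| := by
  simp [nodeProd_eq_ite, Fin.prod_univ_succ]

lemma nodeProd_succ {n : ℕ} (x : Fin (n + 1) → ℝ) (j : Fin n) :
    nodeProd x j.succ = |x j.succ - x 0| * nodeProd (fun i => x i.succ) j := by
  simp [nodeProd_eq_ite, Fin.prod_univ_succ, (Fin.succ_ne_zero _).symm]

lemma nodeProd_last {n : ℕ} (x : Fin (n + 1) → ℝ) :
    nodeProd x (Fin.last n) = ∏ i : Fin n, |x (Fin.last n) - x i.castSucc| := by
  simp [nodeProd_eq_ite, Fin.prod_univ_castSucc, Fin.castSucc_ne_last]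

lemma nodeProd_castSucc {n : ℕ} (x : Fin (n + 1) → ℝ) (j : Fin n) :
    nodeProd x j.castSucc =
      nodeProd (fun i => x i.castSucc) j * |x j.castSucc - x (Fin.last n)| := by
  simp [nodeProd_eq_ite, Fin.prod_univ_castSucc, (Fin.castSucc_ne_last _).symm]

lemma prod_nodeProd {n : ℕ} (x : Fin n → ℝ) : ∏ j, nodeProd x j = diffProd x ^ 2 := by
  induction n with
  | zero => simp [diffProd]
  | succ n ih =>
    rw [Fin.prod_univ_succ, nodeProd_zero, diffProd_succ]
    simp only [nodeProd_succ, Finset.prod_mul_distrib, ih, abs_sub_comm (x 0)]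
    rw [mul_pow, ← sq_abs (∏ j : Fin n, (x j.succ - x 0)), Finset.abs_prod]
    ring

lemma diffProd_pos {n : ℕ} {t : Fin n → ℝ} (ht : StrictMono t) : 0 < diffProd t :=
  Finset.prod_pos fun _ _ => Finset.prod_pos fun _ hj => sub_pos.2 (ht (Finset.mem_Ioi.1 hj))

lemma nodeProd_pos {n : ℕ} {x : Fin n → ℝ} (hx : Function.Injective x) (j : Fin n) :
    0 < nodeProd x j :=
  Finset.prod_pos fun _ hi => abs_pos.2 (sub_ne_zero.2 (hx.ne (Finset.ne_of_mem_erase hi).symm))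

lemma ofReal_prod_cpow {ι : Type*} (s : Finset ι) {f : ι → ℝ} (hf : ∀ i ∈ s, 0 ≤ f i) (z : ℂ) :
    ((∏ i ∈ s, f i : ℝ) : ℂ) ^ z = ∏ i ∈ s, ((f i : ℝ) : ℂ) ^ z := by
  induction s using Finset.cons_induction with
  | empty => simp
  | cons a s ha ih =>
    rw [Finset.prod_cons, Finset.prod_cons, Complex.ofReal_mul, Complex.mul_cpow_ofReal_nonneg
      (hf a (by simp)) (Finset.prod_nonneg fun i hi => hf i (by simp [hi])),
      ih fun i hi => hf i (by simp [hi])]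

/-- The one-point weight `∏ t_i^{α-1} (1-t_i)^{β-1}` of the Selberg integral. -/
noncomputable def betaWeight {n : ℕ} (α β : ℂ) (t : Fin n → ℝ) : ℂ :=
  ∏ i, ((t i : ℂ) ^ (α - 1) * ((1 - t i : ℝ) : ℂ) ^ (β - 1))

lemma selbergIntegrand_eq {n : ℕ} (α β γ : ℂ) {t : Fin n → ℝ} (ht : t ∈ orderedSimplex n) :
    selbergIntegrand n α β γ t = betaWeight α β t * (diffProd t : ℂ) ^ (2 * γ) := by
  rw [selbergIntegrand, betaWeight, diffProd, ofReal_prod_cpow]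
  · congr 1
    rw [Finset.prod_filter, ← Finset.univ_product_univ, Finset.prod_product]
    refine Finset.prod_congr rfl fun i _ => ?_
    rw [← Finset.prod_filter, ofReal_prod_cpow]
    · refine Finset.prod_congr (by ext; simp) fun j hj => ?_
      rw [abs_sub_comm, abs_of_pos (sub_pos.2 (ht.1 (by simpa using hj)))]
    · exact fun j hj => (sub_pos.2 (ht.1 (by simpa using hj))).le
  · exact fun i _ => Finset.prod_nonneg fun j hj => (sub_pos.2 (ht.1 (by simpa using hj))).le

lemma integrableOn_and_setIntegral_sections {X Y : Type*} [MeasureSpace X] [MeasureSpace Y]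
    [SFinite (volume : Measure X)] [SFinite (volume : Measure Y)]
    {f : X × Y → ℂ} {S : Set X} {T : X → Set Y} {R : Set (X × Y)}
    (hRmem : ∀ x y, (x, y) ∈ R ↔ x ∈ S ∧ y ∈ T x)
    (hS : MeasurableSet S) (hT : ∀ x ∈ S, MeasurableSet (T x)) (hR : MeasurableSet R)
    (hf : AEStronglyMeasurable f (volume.restrict R))
    (hsec : ∀ x ∈ S, IntegrableOn (fun y => f (x, y)) (T x))
    (hnorm : IntegrableOn (fun x => ∫ y in T x, ‖f (x, y)‖) S) :
    IntegrableOn f R ∧ ∫ p in R, f p = ∫ x in S, ∫ y in T x, f (x, y) := by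
  have hind : ∀ x ∈ S, ∀ y, R.indicator f (x, y) = (T x).indicator (fun y => f (x, y)) y := by
    intro x hx y
    by_cases hy : y ∈ T x
    · rw [Set.indicator_of_mem ((hRmem x y).2 ⟨hx, hy⟩), Set.indicator_of_mem hy]
    · rw [Set.indicator_of_notMem (fun h => hy ((hRmem x y).1 h).2), Set.indicator_of_notMem hy]
  have hind0 : ∀ x ∉ S, ∀ y, R.indicator f (x, y) = 0 := fun x hx y =>
    Set.indicator_of_notMem (fun h => hx ((hRmem x y).1 h).1) f
  have hint : Integrable (R.indicator f) := by
    rw [Measure.volume_eq_prod, integrable_prod_iff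
      (by rw [← Measure.volume_eq_prod]; exact (aestronglyMeasurable_indicator_iff hR).2 hf)]
    refine ⟨Filter.Eventually.of_forall fun x => ?_, ?_⟩
    · by_cases hx : x ∈ S
      · simp only [hind x hx]
        exact (integrable_indicator_iff (hT x hx)).2 (hsec x hx)
      · simp [hind0 x hx]
    · refine ((integrable_indicator_iff hS).2 hnorm).congr (Filter.Eventually.of_forall fun x => ?_)
      by_cases hx : x ∈ S
      · simp only [hind x hx, Set.indicator_of_mem hx, norm_indicator_eq_indicator_norm]
        rw [integral_indicator (hT x hx)]
      · simp [hind0 x hx, Set.indicator_of_notMem hx]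
  refine ⟨(integrable_indicator_iff hR).1 hint, ?_⟩
  rw [← integral_indicator hR, Measure.volume_eq_prod, integral_prod _
    (by rw [← Measure.volume_eq_prod]; exact hint), ← integral_indicator hS]
  congr 1
  funext x
  by_cases hx : x ∈ S
  · simp only [hind x hx, Set.indicator_of_mem hx]
    rw [integral_indicator (hT x hx)]
  · simp [hind0 x hx, Set.indicator_of_notMem hx]

lemma ofReal_norm_cpow {x : ℝ} (hx : 0 < x) (z : ℂ) :
    ((‖(x : ℂ) ^ z‖ : ℝ) : ℂ) = (x : ℂ) ^ (z.re : ℂ) := by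
  rw [Complex.norm_cpow_eq_rpow_re_of_pos hx, Complex.ofReal_cpow hx.le]

lemma integrableOn_beta {u v : ℂ} (hu : 0 < u.re) (hv : 0 < v.re) {R : ℝ} (hR : 0 < R) :
    IntegrableOn (fun x : ℝ => (x : ℂ) ^ (u - 1) * ((R - x : ℝ) : ℂ) ^ (v - 1))
      (Set.Ioo 0 R) := by
  have h := (Complex.betaIntegral_convergent hu hv).comp_mul_left (c := R⁻¹)
  rw [zero_div, one_div, inv_inv, intervalIntegrable_iff_integrableOn_Ioo_of_le hR.le] at h
  refine IntegrableOn.congr_fun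
    (Integrable.const_mul h ((R : ℂ) ^ (u - 1) * (R : ℂ) ^ (v - 1))) ?_ measurableSet_Ioo
  intro x hx
  have h1 : (x : ℂ) ^ (u - 1) = (R : ℂ) ^ (u - 1) * ((R⁻¹ * x : ℝ) : ℂ) ^ (u - 1) := by
    rw [← Complex.mul_cpow_ofReal_nonneg hR.le (mul_pos (inv_pos.2 hR) hx.1).le,
      ← Complex.ofReal_mul, mul_inv_cancel_left₀ hR.ne']
  have h2 : ((R - x : ℝ) : ℂ) ^ (v - 1)
      = (R : ℂ) ^ (v - 1) * ((1 - R⁻¹ * x : ℝ) : ℂ) ^ (v - 1) := by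
    have : 0 ≤ 1 - R⁻¹ * x := by
      have := mul_le_mul_of_nonneg_left hx.2.le (inv_pos.2 hR).le
      rw [inv_mul_cancel₀ hR.ne'] at this
      linarith
    rw [← Complex.mul_cpow_ofReal_nonneg hR.le this, ← Complex.ofReal_mul, mul_sub,
      mul_inv_cancel_left₀ hR.ne', mul_one]
  simp only [h1, h2]
  push_cast
  ring

lemma setIntegral_beta {u v : ℂ} (hu : 0 < u.re) (hv : 0 < v.re) {R : ℝ} (hR : 0 < R) :
    ∫ x in Set.Ioo 0 R, (x : ℂ) ^ (u - 1) * ((R - x : ℝ) : ℂ) ^ (v - 1)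
      = (R : ℂ) ^ (u + v - 1) * (Complex.Gamma u * Complex.Gamma v / Complex.Gamma (u + v)) := by
  rw [Complex.Gamma_mul_Gamma_eq_betaIntegral hu hv, mul_div_cancel_left₀ _
    (Complex.Gamma_ne_zero_of_re_pos (by simpa using add_pos hu hv)),
    ← Complex.betaIntegral_scaled u v hR, intervalIntegral.integral_of_le hR.le,
    integral_Ioc_eq_integral_Ioo]
  simp

/-- The open simplex `{u | 0 < u_j, ∑ u_j < R}`. -/
def openSimplex (n : ℕ) (R : ℝ) : Set (Fin n → ℝ) :=
  {u | (∀ j, 0 < u j) ∧ ∑ j, u j < R}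

lemma measurableSet_openSimplex (n : ℕ) (R : ℝ) : MeasurableSet (openSimplex n R) := by
  have : openSimplex n R = (⋂ j, {u | 0 < u j}) ∩ {u | ∑ j, u j < R} := by
    ext; simp [openSimplex]
  rw [this]
  exact (MeasurableSet.iInter fun j =>
    measurableSet_lt measurable_const (measurable_pi_apply j)).inter
    (measurableSet_lt (by fun_prop) measurable_const)

/-- The integrand of the Dirichlet integral over `openSimplex n R`. -/
noncomputable def dirichletIntegrand {n : ℕ} (s₀ : ℂ) (s : Fin n → ℂ) (R : ℝ) (u : Fin n → ℝ) : ℂ :=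
  (∏ j, (u j : ℂ) ^ (s j - 1)) * ((R - ∑ j, u j : ℝ) : ℂ) ^ (s₀ - 1)

lemma measurable_dirichletIntegrand {n : ℕ} (s₀ : ℂ) (s : Fin n → ℂ) (R : ℝ) :
    Measurable (dirichletIntegrand s₀ s R) := by
  unfold dirichletIntegrand
  fun_prop

lemma ofReal_norm_dirichletIntegrand {n : ℕ} (s₀ : ℂ) (s : Fin n → ℂ) {R : ℝ} {u : Fin n → ℝ}
    (hu : u ∈ openSimplex n R) :
    ((‖dirichletIntegrand s₀ s R u‖ : ℝ) : ℂ)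
      = dirichletIntegrand (s₀.re : ℂ) (fun j => ((s j).re : ℂ)) R u := by
  simp only [dirichletIntegrand, norm_mul, norm_prod, Complex.ofReal_mul, Complex.ofReal_prod]
  rw [ofReal_norm_cpow (sub_pos.2 hu.2)]
  simp [ofReal_norm_cpow (hu.1 _)]

theorem dirichlet_integral (n : ℕ) (s₀ : ℂ) (s : Fin n → ℂ) (hs₀ : 0 < s₀.re)
    (hs : ∀ j, 0 < (s j).re) {R : ℝ} (hR : 0 < R) :
    IntegrableOn (dirichletIntegrand s₀ s R) (openSimplex n R) ∧
      ∫ u in openSimplex n R, dirichletIntegrand s₀ s R u =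
        (R : ℂ) ^ (s₀ + ∑ j, s j - 1) *
          ((Complex.Gamma s₀ * ∏ j, Complex.Gamma (s j)) / Complex.Gamma (s₀ + ∑ j, s j)) := by
  induction n generalizing s₀ R with
  | zero =>
    have huniv : openSimplex 0 R = Set.univ := by
      ext; simp [openSimplex, hR]
    have hfun : dirichletIntegrand s₀ s R = fun _ => (R : ℂ) ^ (s₀ - 1) := by
      funext; simp [dirichletIntegrand]
    rw [huniv, hfun]
    refine ⟨by simp, ?_⟩
    simp [div_self (Complex.Gamma_ne_zero_of_re_pos hs₀), Measure.real, volume_pi]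
  | succ n ih =>
    set e := MeasurableEquiv.piFinSuccAbove (fun _ : Fin (n + 1) => ℝ) 0
    have he : MeasurePreserving e.symm :=
      (volume_preserving_piFinSuccAbove (fun _ : Fin (n + 1) => ℝ) 0).symm
    have he0 : ∀ p, e.symm p 0 = p.1 := fun p => by
      simp [e, MeasurableEquiv.piFinSuccAbove, Fin.insertNthEquiv]
    have hes : ∀ p, ∀ j : Fin n, e.symm p j.succ = p.2 j := fun p j => by
      simp [e, MeasurableEquiv.piFinSuccAbove, Fin.insertNthEquiv]
    have hsum : ∀ p, ∑ j, e.symm p j = p.1 + ∑ j, p.2 j := fun p => by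
      simp [Fin.sum_univ_succ, he0, hes]
    set s' : Fin n → ℂ := fun j => s j.succ with hs'
    have hfac : ∀ p, dirichletIntegrand s₀ s R (e.symm p)
        = (p.1 : ℂ) ^ (s 0 - 1) * dirichletIntegrand s₀ s' (R - p.1) p.2 := by
      intro p
      simp only [dirichletIntegrand, Fin.prod_univ_succ, he0, hes, hsum, sub_sub, mul_assoc, hs']
    have hS : ∀ x y, (x, y) ∈ e.symm ⁻¹' openSimplex (n + 1) R ↔
        x ∈ Set.Ioo 0 R ∧ y ∈ openSimplex n (R - x) := by
      intro x y
      simp only [openSimplex, Set.mem_preimage, Set.mem_ofPred_eq, Fin.forall_fin_succ, he0, hes,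
        hsum, Set.mem_Ioo]
      constructor
      · rintro ⟨⟨h1, h2⟩, h3⟩
        exact ⟨⟨h1, by linarith [Finset.sum_nonneg fun i (_ : i ∈ Finset.univ) => (h2 i).le]⟩, h2,
          by linarith⟩
      · rintro ⟨⟨h1, -⟩, h2, h3⟩
        exact ⟨⟨h1, h2⟩, by linarith⟩
    have hsre : ∀ j, 0 < (s' j).re := fun j => hs j.succ
    have hsumre : 0 < (s₀ + ∑ j, s' j).re := by
      simpa using add_pos_of_pos_of_nonneg hs₀ (Finset.sum_nonneg fun j _ => (hsre j).le)
    have hnormint : ∀ x ∈ Set.Ioo 0 R,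
        ((∫ y in openSimplex n (R - x), ‖dirichletIntegrand s₀ s R (e.symm (x, y))‖ : ℝ) : ℂ)
        = ((Complex.Gamma (s₀.re : ℂ) * ∏ j, Complex.Gamma ((s' j).re : ℂ)) /
            Complex.Gamma ((s₀.re : ℂ) + ∑ j, ((s' j).re : ℂ))) *
          ((x : ℂ) ^ (((s 0).re : ℂ) - 1) *
          ((R - x : ℝ) : ℂ) ^ (((s₀.re : ℂ) + ∑ j, ((s' j).re : ℂ)) - 1)) := by
      intro x hx
      have h := (ih (s₀.re : ℂ) (fun j => ((s' j).re : ℂ)) (by simpa) (by simpa)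
        (sub_pos.2 hx.2)).2
      rw [← integral_complex_ofReal]
      have : Set.EqOn (fun y => ((‖dirichletIntegrand s₀ s R (e.symm (x, y))‖ : ℝ) : ℂ))
          (fun y => (x : ℂ) ^ (((s 0).re : ℂ) - 1) *
            dirichletIntegrand (s₀.re : ℂ) (fun j => ((s' j).re : ℂ)) (R - x) y)
          (openSimplex n (R - x)) := by
        intro y hy
        simp only [hfac, norm_mul, Complex.ofReal_mul]
        rw [ofReal_norm_cpow hx.1, ofReal_norm_dirichletIntegrand _ _ hy]
        simp
      rw [setIntegral_congr_fun (measurableSet_openSimplex _ _) this, integral_const_mul, h]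
      ring
    obtain ⟨h1, h2⟩ := integrableOn_and_setIntegral_sections
      (f := fun p => dirichletIntegrand s₀ s R (e.symm p)) hS measurableSet_Ioo
      (fun x _ => measurableSet_openSimplex _ _)
      (e.symm.measurable (measurableSet_openSimplex _ _))
      ((measurable_dirichletIntegrand s₀ s R).comp e.symm.measurable).aestronglyMeasurable
      (fun x hx => by
        simp only [hfac]
        exact (ih s₀ s' hs₀ hsre (sub_pos.2 hx.2)).1.const_mul _)
      (by
        have := IntegrableOn.congr_fun (Integrable.const_mul
          (integrableOn_beta (u := ((s 0).re : ℂ)) (v := (s₀.re : ℂ) + ∑ j, ((s' j).re : ℂ))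
            (by simpa using hs 0) (by simpa using hsumre) hR)
          ((Complex.Gamma (s₀.re : ℂ) * ∏ j, Complex.Gamma ((s' j).re : ℂ)) /
            Complex.Gamma ((s₀.re : ℂ) + ∑ j, ((s' j).re : ℂ))))
          (fun x hx => (hnormint x hx).symm) measurableSet_Ioo
        rw [IntegrableOn]
        simpa only [RCLike.re_to_complex, Complex.ofReal_re] using this.re)
    refine ⟨(he.integrableOn_comp_preimage e.symm.measurableEmbedding).1 h1, ?_⟩
    rw [← he.setIntegral_preimage_emb e.symm.measurableEmbedding, h2]
    have : Set.EqOn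
        (fun x => ∫ y in openSimplex n (R - x), dirichletIntegrand s₀ s R (e.symm (x, y)))
        (fun x : ℝ =>
          ((Complex.Gamma s₀ * ∏ j, Complex.Gamma (s' j)) / Complex.Gamma (s₀ + ∑ j, s' j)) *
          ((x : ℂ) ^ (s 0 - 1) * ((R - x : ℝ) : ℂ) ^ ((s₀ + ∑ j, s' j) - 1))) (Set.Ioo 0 R) := by
      intro x hx
      simp only [hfac]
      rw [integral_const_mul, (ih s₀ s' hs₀ hsre (sub_pos.2 hx.2)).2]
      ring
    rw [setIntegral_congr_fun measurableSet_Ioo this, integral_const_mul,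
      setIntegral_beta (hs 0) hsumre hR, Fin.sum_univ_succ, Fin.prod_univ_succ]
    have hne := Complex.Gamma_ne_zero_of_re_pos hsumre
    simp only [hs'] at hne ⊢
    rw [show s₀ + (s 0 + ∑ i : Fin n, s i.succ) = s 0 + (s₀ + ∑ j : Fin n, s j.succ) by ring]
    field_simp

/-- The set of points `y` interlacing the nodes `x`: `x_0 < y_0 < x_1 < … < y_{n-1} < x_n`. -/
def interlacing {n : ℕ} (x : Fin (n + 1) → ℝ) : Set (Fin n → ℝ) :=
  {y | ∀ i, x i.castSucc < y i ∧ y i < x i.succ}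

/-- The coefficients `∏_i (x_j - y_i) / ∏_{i ≠ j} (x_j - x_i)` of the partial fraction expansion
of `∏ (T - y_i) / ∏ (T - x_j)`. -/
noncomputable def residueCoeff {n : ℕ} (x : Fin (n + 1) → ℝ) (y : Fin n → ℝ) (j : Fin (n + 1)) :
    ℝ :=
  ∏ i, (x j - y i) / (x j - x (j.succAbove i))

lemma isOpen_interlacing {n : ℕ} (x : Fin (n + 1) → ℝ) : IsOpen (interlacing x) := by
  have : interlacing x = ⋂ i, {y | x i.castSucc < y i ∧ y i < x i.succ} := by
    ext; simp [interlacing]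
  rw [this]
  exact isOpen_iInter_of_finite fun i =>
    (isOpen_lt continuous_const (continuous_apply i)).inter
      (isOpen_lt (continuous_apply i) continuous_const)

lemma lt_of_mem_interlacing {n : ℕ} {x : Fin (n + 1) → ℝ} (hx : StrictMono x) {y y' : Fin n → ℝ}
    (hy : y ∈ interlacing x) (hy' : y' ∈ interlacing x) {i j : Fin n} (hij : i < j) :
    y i < y' j :=
  ((hy i).2.trans_le (hx.monotone (by
    rw [Fin.le_def]; simpa [Nat.succ_le_iff] using hij))).trans (hy' j).1

lemma nodeProd_eq_succAbove {n : ℕ} (x : Fin (n + 1) → ℝ) (j : Fin (n + 1)) :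
    nodeProd x j = ∏ i, |x j - x (j.succAbove i)| := by
  rw [nodeProd_eq_ite, Fin.prod_univ_succAbove _ j]
  simp [Fin.succAbove_ne]

lemma residueCoeff_pos {n : ℕ} {x : Fin (n + 1) → ℝ} (hx : StrictMono x) {y : Fin n → ℝ}
    (hy : y ∈ interlacing x) (j : Fin (n + 1)) : 0 < residueCoeff x y j := by
  refine Finset.prod_pos fun i _ => ?_
  rcases lt_or_ge i.castSucc j with h | h
  · rw [Fin.succAbove_of_castSucc_lt _ _ h]
    have h' : i.succ ≤ j := Fin.castSucc_lt_iff_succ_le.1 h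
    exact div_pos (sub_pos.2 ((hy i).2.trans_le (hx.monotone h'))) (sub_pos.2 (hx h))
  · rw [Fin.succAbove_of_le_castSucc _ _ h]
    exact div_pos_of_neg_of_neg (sub_neg.2 ((hx.monotone h).trans_lt (hy i).1))
      (sub_neg.2 (hx (h.trans_lt Fin.castSucc_lt_succ)))

lemma residueCoeff_eq_abs {n : ℕ} {x : Fin (n + 1) → ℝ} (hx : StrictMono x) {y : Fin n → ℝ}
    (hy : y ∈ interlacing x) (j : Fin (n + 1)) :
    residueCoeff x y j = (∏ i, |x j - y i|) / nodeProd x j := by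
  rw [← abs_of_pos (residueCoeff_pos hx hy j), residueCoeff, Finset.abs_prod,
    nodeProd_eq_succAbove, ← Finset.prod_div_distrib]
  simp [abs_div]

open Polynomial in
lemma natDegree_prod_X_sub_C_fin {n : ℕ} (y : Fin n → ℝ) :
    (∏ i, (X - C (y i)) : ℝ[X]).natDegree = n := by
  rw [natDegree_prod_of_monic _ _ fun i _ => monic_X_sub_C _]
  simp

open Polynomial in
lemma sum_residueCoeff {n : ℕ} {x : Fin (n + 1) → ℝ} (hx : StrictMono x) (y : Fin n → ℝ) :
    ∑ j, residueCoeff x y j = 1 := by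
  have hm : (∏ i, (X - C (y i)) : ℝ[X]).Monic := monic_prod_of_monic _ _ fun i _ => monic_X_sub_C _
  have h := Lagrange.leadingCoeff_eq_sum (s := Finset.univ) (v := x) hx.injective.injOn
    (P := ∏ i, (X - C (y i))) (by
      rw [degree_eq_natDegree hm.ne_zero, natDegree_prod_X_sub_C_fin]; simp)
  rw [hm.leadingCoeff] at h
  rw [h]
  refine Finset.sum_congr rfl fun j _ => ?_
  rw [residueCoeff, Finset.prod_div_distrib, eval_prod]
  simp only [eval_sub, eval_X, eval_C]
  congr 1
  have : ∏ i ∈ Finset.univ.erase j, (x j - x i) = ∏ i, if i = j then 1 else x j - x i := by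
    rw [← Finset.mul_prod_erase Finset.univ _ (Finset.mem_univ j), if_pos rfl, one_mul]
    exact Finset.prod_congr rfl fun i hi => (if_neg (Finset.ne_of_mem_erase hi)).symm
  rw [this, Fin.prod_univ_succAbove _ j]
  simp [Fin.succAbove_ne]

open Polynomial in
lemma abs_det_eval_prod_erase {n : ℕ} (u : Fin n → ℝ) {y : Fin n → ℝ} (hy : StrictMono y) :
    |(Matrix.of fun j i => ∏ l ∈ Finset.univ.erase i, (u j - y l)).det|
      = |diffProd u| * diffProd y := by
  set p : Fin n → ℝ[X] := fun i => ∏ l ∈ Finset.univ.erase i, (X - C (y l)) with hp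
  have hfac : ∀ v : Fin n → ℝ, (Matrix.of fun j i => ∏ l ∈ Finset.univ.erase i, (v j - y l))
      = Matrix.vandermonde v * Matrix.of fun (k i : Fin n) => (p i).coeff k := by
    intro v
    ext j i
    have hdeg : (p i).natDegree < n := by
      rw [hp, natDegree_prod_of_monic _ _ fun i _ => monic_X_sub_C _]
      have := i.2
      simp
      omega
    rw [Matrix.mul_apply]
    simp only [Matrix.of_apply, Matrix.vandermonde_apply]
    calc _ = (p i).eval (v j) := by simp [hp, eval_prod]
      _ = _ := by
        rw [eval_eq_sum_range' hdeg, ← Fin.sum_univ_eq_sum_range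
          (fun k => (p i).coeff k * v j ^ k)]
        exact Finset.sum_congr rfl fun _ _ => mul_comm _ _
  have hdiag : (Matrix.of fun j i => ∏ l ∈ Finset.univ.erase i, (y j - y l))
      = Matrix.diagonal fun i => ∏ l ∈ Finset.univ.erase i, (y i - y l) := by
    ext j i
    rcases eq_or_ne j i with rfl | h
    · simp
    · rw [Matrix.diagonal_apply_ne _ h]
      exact Finset.prod_eq_zero (Finset.mem_erase.2 ⟨h, Finset.mem_univ j⟩) (sub_self _)
  have hy' := congrArg (fun M => |Matrix.det M|) (hfac y)
  simp only [Matrix.det_mul, abs_mul, Matrix.det_vandermonde] at hy'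
  rw [hdiag, Matrix.det_diagonal, Finset.abs_prod] at hy'
  simp only [Finset.abs_prod (Finset.univ.erase _)] at hy'
  have hpos := diffProd_pos hy
  have h1 : ∏ i, nodeProd y i = |diffProd y| *
    |(Matrix.of fun (k i : Fin n) => (p i).coeff k).det| := hy'
  rw [prod_nodeProd, abs_of_pos hpos, pow_two] at h1
  rw [hfac u, Matrix.det_mul, abs_mul, Matrix.det_vandermonde,
    mul_left_cancel₀ hpos.ne' h1, diffProd]

/-- The derivative of `y ↦ (residueCoeff x y j.succ)_j`. -/
noncomputable def residueDeriv {n : ℕ} (x : Fin (n + 1) → ℝ) (y : Fin n → ℝ) :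
    (Fin n → ℝ) →L[ℝ] (Fin n → ℝ) :=
  LinearMap.toContinuousLinearMap (Matrix.toLin' (Matrix.of fun (j i : Fin n) =>
    (-(∏ l, (x j.succ - x (j.succ.succAbove l)))⁻¹) *
      ∏ l ∈ Finset.univ.erase i, (x j.succ - y l)))

lemma hasFDerivAt_residueCoeff {n : ℕ} (x : Fin (n + 1) → ℝ) (y : Fin n → ℝ) :
    HasFDerivAt (fun y (j : Fin n) => residueCoeff x y j.succ) (residueDeriv x y) y := by
  rw [hasFDerivAt_pi']
  intro j
  have h1 : ∀ i ∈ Finset.univ, HasFDerivAt (fun y : Fin n → ℝ => x j.succ - y i)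
      (-(ContinuousLinearMap.proj i : (Fin n → ℝ) →L[ℝ] ℝ)) y := fun i _ =>
    (hasFDerivAt_apply i y).const_sub _
  have h2 := (HasFDerivAt.finsetProd h1).const_mul
    ((∏ l, (x j.succ - x (j.succ.succAbove l)))⁻¹)
  have h3 : (fun y => residueCoeff x y j.succ) = fun y =>
      (∏ l, (x j.succ - x (j.succ.succAbove l)))⁻¹ * ∏ i, (x j.succ - y i) := by
    funext y
    rw [residueCoeff, Finset.prod_div_distrib, div_eq_inv_mul]
  rw [h3]
  refine h2.congr_fderiv ?_
  ext v
  simp [residueDeriv, Matrix.mulVec, dotProduct, Finset.mul_sum, mul_assoc]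

lemma abs_det_residueDeriv {n : ℕ} {x : Fin (n + 1) → ℝ} (hx : StrictMono x) {y : Fin n → ℝ}
    (hy : StrictMono y) : |(residueDeriv x y).det| = diffProd y / diffProd x := by
  have hx' : StrictMono fun i : Fin n => x i.succ := hx.comp (Fin.strictMono_succ)
  have h0 : 0 < ∏ j : Fin n, (x j.succ - x 0) :=
    Finset.prod_pos fun j _ => sub_pos.2 (hx (Fin.succ_pos j))
  have h1 : ∏ j : Fin n, nodeProd x j.succ =
      (∏ j : Fin n, (x j.succ - x 0)) * diffProd (fun i : Fin n => x i.succ) ^ 2 := by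
    simp only [nodeProd_succ, Finset.prod_mul_distrib, prod_nodeProd]
    rw [← Finset.abs_prod, abs_of_pos h0]
  rw [residueDeriv, LinearMap.det_toContinuousLinearMap, LinearMap.det_toLin',
    Matrix.det_mul_column (fun j : Fin n => (-(∏ l, (x j.succ - x (j.succ.succAbove l)))⁻¹))
      (fun j i => ∏ l ∈ Finset.univ.erase i, (x j.succ - y l)), abs_mul]
  rw [show (Matrix.det fun j i => ∏ l ∈ Finset.univ.erase i, (x j.succ - y l)) =
    (Matrix.of fun j i => ∏ l ∈ Finset.univ.erase i, (x (Fin.succ j) - y l)).det from rfl,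
    abs_det_eval_prod_erase (fun j : Fin n => x j.succ) hy, Finset.abs_prod]
  simp only [abs_neg, abs_inv, Finset.abs_prod, ← nodeProd_eq_succAbove]
  rw [Finset.prod_inv_distrib, h1, diffProd_succ x, abs_of_pos (diffProd_pos hx')]
  have := diffProd_pos hx'
  field_simp

open Polynomial in
lemma injOn_residueCoeff {n : ℕ} {x : Fin (n + 1) → ℝ} (hx : StrictMono x) :
    Set.InjOn (fun y (j : Fin n) => residueCoeff x y j.succ) (interlacing x) := by
  intro y hy y' hy' h
  have hm : ∀ y : Fin n → ℝ, (∏ i, (X - C (y i)) : ℝ[X]).Monic := fun y =>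
    monic_prod_of_monic _ _ fun i _ => monic_X_sub_C _
  have hdeg : ∀ y : Fin n → ℝ, (∏ i, (X - C (y i)) : ℝ[X]).degree = n := fun y => by
    rw [degree_eq_natDegree (hm y).ne_zero, natDegree_prod_X_sub_C_fin]
  have hpoly : (∏ i, (X - C (y i)) : ℝ[X]) = ∏ i, (X - C (y' i)) := by
    refine eq_of_degree_le_of_eval_index_eq (v := fun j : Fin n => x j.succ) Finset.univ
      (hx.comp Fin.strictMono_succ).injective.injOn (by simp [hdeg]) (by simp [hdeg])
      (by rw [hm, hm]) fun j _ => ?_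
    have hj := congrFun h j
    simp only [residueCoeff, Finset.prod_div_distrib] at hj
    rw [div_left_inj' (Finset.prod_ne_zero_iff.2 fun i _ =>
      sub_ne_zero.2 (hx.injective.ne (Fin.succAbove_ne _ _).symm))] at hj
    simpa [eval_prod] using hj
  funext i
  have h0 := congrArg (Polynomial.eval (y i)) hpoly
  rw [eval_prod, eval_prod, Finset.prod_eq_zero (Finset.mem_univ i) (by simp), eq_comm,
    Finset.prod_eq_zero_iff] at h0
  obtain ⟨l, -, hl⟩ := h0
  have hl : y i = y' l := by simpa [sub_eq_zero] using hl
  rcases lt_trichotomy i l with hil | rfl | hil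
  · exact absurd hl (lt_of_mem_interlacing hx hy hy' hil).ne
  · exact hl
  · exact absurd hl.symm (lt_of_mem_interlacing hx hy' hy hil).ne

open Polynomial in
lemma exists_residueCoeff_eq {n : ℕ} {x : Fin (n + 1) → ℝ} (hx : StrictMono x)
    {c : Fin (n + 1) → ℝ} (hc : ∀ j, 0 < c j) (hsum : ∑ j, c j = 1) :
    ∃ y ∈ interlacing x, residueCoeff x y = c := by
  set E : Fin (n + 1) → ℝ := fun j => ∏ l, (x j - x (j.succAbove l)) with hE
  have hE0 : ∀ j, E j ≠ 0 := fun j => Finset.prod_ne_zero_iff.2 fun i _ =>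
      sub_ne_zero.2 (hx.injective.ne (Fin.succAbove_ne _ _).symm)
  set Q : ℝ[X] := ∑ j, C (c j) * ∏ l, (X - C (x (j.succAbove l))) with hQ
  have hm : ∀ y : Fin n → ℝ, (∏ i, (X - C (y i)) : ℝ[X]).Monic := fun y =>
    monic_prod_of_monic _ _ fun i _ => monic_X_sub_C _
  have hQdeg : Q.natDegree ≤ n := by
    refine natDegree_sum_le_of_forall_le _ _ fun j _ => (natDegree_C_mul_le _ _).trans ?_
    rw [natDegree_prod_X_sub_C_fin]
  have hQm : Q.Monic := by
    refine monic_of_natDegree_le_of_coeff_eq_one n hQdeg ?_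
    rw [hQ, finsetSum_coeff, ← hsum]
    refine Finset.sum_congr rfl fun j _ => ?_
    have := (hm fun l => x (j.succAbove l)).coeff_natDegree
    rw [natDegree_prod_X_sub_C_fin] at this
    rw [coeff_C_mul, this, mul_one]
  have hQn : Q.natDegree = n := by
    refine le_antisymm hQdeg (le_natDegree_of_ne_zero ?_)
    rw [hQ, finsetSum_coeff]
    have : ∀ j, (C (c j) * ∏ l, (X - C (x (j.succAbove l)))).coeff n = c j := fun j => by
      have := (hm fun l => x (j.succAbove l)).coeff_natDegree
      rw [natDegree_prod_X_sub_C_fin] at this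
      rw [coeff_C_mul, this, mul_one]
    simp [this, hsum]
  have heval : ∀ j, Q.eval (x j) = c j * E j := by
    intro j
    rw [hQ, eval_finsetSum, Finset.sum_eq_single j]
    · simp [eval_prod, hE]
    · intro i _ hij
      obtain ⟨l, hl⟩ := Fin.exists_succAbove_eq hij.symm
      rw [eval_mul, eval_prod, Finset.prod_eq_zero (Finset.mem_univ l) (by simp [hl]), mul_zero]
    · simp
  have hsign : ∀ i : Fin n, E i.castSucc * E i.succ < 0 := by
    intro i
    rw [hE, ← Finset.prod_mul_distrib, ← Finset.mul_prod_erase Finset.univ _ (Finset.mem_univ i)]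
    refine mul_neg_of_neg_of_pos ?_ (Finset.prod_pos fun l hl => ?_)
    · have := hx (Fin.castSucc_lt_succ (i := i))
      rw [Fin.succAbove_of_le_castSucc _ _ le_rfl,
        Fin.succAbove_of_castSucc_lt _ _ (Fin.castSucc_lt_succ (i := i))]
      nlinarith
    · rcases lt_or_gt_of_ne (Finset.ne_of_mem_erase hl) with h | h
      · have h1 : l.castSucc < i.castSucc := by simpa using h
        have h2 : l.castSucc < i.succ := h1.trans Fin.castSucc_lt_succ
        rw [Fin.succAbove_of_castSucc_lt _ _ h1, Fin.succAbove_of_castSucc_lt _ _ h2]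
        exact mul_pos (sub_pos.2 (hx h1)) (sub_pos.2 (hx h2))
      · have h1 : i.succ ≤ l.castSucc := by
          rw [Fin.le_def]; simpa [Nat.succ_le_iff] using h
        have h2 : i.castSucc ≤ l.castSucc := Fin.castSucc_lt_succ.le.trans h1
        rw [Fin.succAbove_of_le_castSucc _ _ h1, Fin.succAbove_of_le_castSucc _ _ h2]
        exact mul_pos_of_neg_of_neg (sub_neg.2 (hx (h2.trans_lt Fin.castSucc_lt_succ)))
          (sub_neg.2 (hx (h1.trans_lt Fin.castSucc_lt_succ)))
  have hroot : ∀ i : Fin n, ∃ t, (x i.castSucc < t ∧ t < x i.succ) ∧ Q.eval t = 0 := by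
    intro i
    have hle := (hx (Fin.castSucc_lt_succ (i := i))).le
    have hprod : Q.eval (x i.castSucc) * Q.eval (x i.succ) < 0 := by
      rw [heval, heval]
      nlinarith [mul_neg_of_pos_of_neg (mul_pos (hc i.castSucc) (hc i.succ)) (hsign i)]
    rcases mul_neg_iff.1 hprod with ⟨h1, h2⟩ | ⟨h1, h2⟩
    · obtain ⟨t, ht, ht0⟩ := intermediate_value_Ioo' hle Q.continuous.continuousOn ⟨h2, h1⟩
      exact ⟨t, ht, ht0⟩
    · obtain ⟨t, ht, ht0⟩ := intermediate_value_Ioo hle Q.continuous.continuousOn ⟨h1, h2⟩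
      exact ⟨t, ht, ht0⟩
  choose y hy hy0 using hroot
  have hymem : y ∈ interlacing x := hy
  have hinj : Function.Injective y :=
    StrictMono.injective fun i j hij => lt_of_mem_interlacing hx hymem hymem hij
  have hQeq : Q = ∏ i, (X - C (y i)) := by
    refine eq_of_degree_le_of_eval_index_eq (v := y) Finset.univ hinj.injOn ?_ ?_ ?_ fun i _ => ?_
    · rw [degree_eq_natDegree hQm.ne_zero, hQn]; simp
    · rw [degree_eq_natDegree hQm.ne_zero, hQn, degree_eq_natDegree (hm y).ne_zero,
        natDegree_prod_X_sub_C_fin]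
    · rw [hQm, hm y]
    · rw [hy0, eval_prod, Finset.prod_eq_zero (Finset.mem_univ i) (by simp)]
  refine ⟨y, hymem, funext fun j => ?_⟩
  have h := heval j
  rw [hQeq, eval_prod] at h
  simp only [eval_sub, eval_X, eval_C] at h
  rw [residueCoeff, Finset.prod_div_distrib, h]
  exact mul_div_cancel_right₀ _ (hE0 j)

lemma image_residueCoeff {n : ℕ} {x : Fin (n + 1) → ℝ} (hx : StrictMono x) :
    (fun y (j : Fin n) => residueCoeff x y j.succ) '' interlacing x = openSimplex n 1 := by
  ext u
  constructor
  · rintro ⟨y, hy, rfl⟩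
    refine ⟨fun j => residueCoeff_pos hx hy _, ?_⟩
    have := sum_residueCoeff hx y
    rw [Fin.sum_univ_succ] at this
    linarith [residueCoeff_pos hx hy 0]
  · intro hu
    obtain ⟨y, hy, h⟩ := exists_residueCoeff_eq hx (c := Fin.cons (1 - ∑ j, u j) u)
      (Fin.cases (by simpa using hu.2) (by simpa using hu.1)) (by simp [Fin.sum_univ_succ])
    exact ⟨y, hy, by simp [h]⟩

/-- The integrand of the Dixon–Anderson integral with nodes `x`. -/
noncomputable def dixonAndersonIntegrand {n : ℕ} (s : Fin (n + 1) → ℂ) (x : Fin (n + 1) → ℝ)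
    (y : Fin n → ℝ) : ℂ :=
  (diffProd y : ℂ) * ∏ j, ((∏ i, |x j - y i| : ℝ) : ℂ) ^ (s j - 1)

lemma strictMono_of_mem_interlacing {n : ℕ} {x : Fin (n + 1) → ℝ} (hx : StrictMono x)
    {y : Fin n → ℝ} (hy : y ∈ interlacing x) : StrictMono y :=
  fun _ _ hij => lt_of_mem_interlacing hx hy hy hij

theorem dixon_anderson_integral {n : ℕ} {s : Fin (n + 1) → ℂ} (hs : ∀ j, 0 < (s j).re)
    {x : Fin (n + 1) → ℝ} (hx : StrictMono x) :
    IntegrableOn (dixonAndersonIntegrand s x) (interlacing x) ∧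
      ∫ y in interlacing x, dixonAndersonIntegrand s x y =
        (∏ j, Complex.Gamma (s j)) / Complex.Gamma (∑ j, s j) *
          ((diffProd x : ℂ) * ∏ j, (nodeProd x j : ℂ) ^ (s j - 1)) := by
  have hmeas := (isOpen_interlacing x).measurableSet
  have hder : ∀ y ∈ interlacing x, HasFDerivWithinAt
      (fun y (j : Fin n) => residueCoeff x y j.succ) (residueDeriv x y) (interlacing x) y :=
    fun y _ => (hasFDerivAt_residueCoeff x y).hasFDerivWithinAt
  have hnode : ∀ j, (nodeProd x j : ℂ) ≠ 0 := fun j =>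
    Complex.ofReal_ne_zero.2 (nodeProd_pos hx.injective j).ne'
  have hx0 : (diffProd x : ℂ) ≠ 0 := Complex.ofReal_ne_zero.2 (diffProd_pos hx).ne'
  have hK0 : ∏ j, (nodeProd x j : ℂ) ^ (s j - 1) ≠ 0 :=
    Finset.prod_ne_zero_iff.2 fun j _ => by simp [Complex.cpow_eq_zero_iff, hnode j]
  have hpt : Set.EqOn (fun y => ((diffProd x : ℂ) * ∏ j, (nodeProd x j : ℂ) ^ (s j - 1)) *
      (|(residueDeriv x y).det| • dirichletIntegrand (s 0) (fun j : Fin n => s j.succ) 1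
        (fun j : Fin n => residueCoeff x y j.succ)))
      (dixonAndersonIntegrand s x) (interlacing x) := by
    intro y hy
    have h0 : 1 - ∑ j : Fin n, residueCoeff x y j.succ = residueCoeff x y 0 := by
      have := sum_residueCoeff hx y
      rw [Fin.sum_univ_succ] at this
      linarith
    have hprod : dirichletIntegrand (s 0) (fun j : Fin n => s j.succ) 1
        (fun j : Fin n => residueCoeff x y j.succ)
        = (∏ j, ((∏ i, |x j - y i| : ℝ) : ℂ) ^ (s j - 1)) /
          ∏ j, (nodeProd x j : ℂ) ^ (s j - 1) := by
      rw [dirichletIntegrand, h0, mul_comm, ← Fin.prod_univ_succ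
        (fun j => (residueCoeff x y j : ℂ) ^ (s j - 1)), ← Finset.prod_div_distrib]
      refine Finset.prod_congr rfl fun j _ => ?_
      rw [eq_div_iff (by simp [Complex.cpow_eq_zero_iff, hnode j]),
        ← Complex.mul_cpow_ofReal_nonneg (residueCoeff_pos hx hy j).le
          (nodeProd_pos hx.injective j).le, ← Complex.ofReal_mul, residueCoeff_eq_abs hx hy,
        div_mul_cancel₀ _ (nodeProd_pos hx.injective j).ne']
    simp only [hprod, abs_det_residueDeriv hx (strictMono_of_mem_interlacing hx hy),
      dixonAndersonIntegrand, Complex.real_smul, Complex.ofReal_div]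
    field_simp
  obtain ⟨h1, h2⟩ := dirichlet_integral n (s 0) (fun j => s j.succ) (hs 0) (fun j => hs j.succ)
    one_pos
  rw [← image_residueCoeff hx] at h1 h2
  rw [integrableOn_image_iff_integrableOn_abs_det_fderiv_smul volume hmeas hder
    (injOn_residueCoeff hx)] at h1
  rw [integral_image_eq_integral_abs_det_fderiv_smul volume hmeas hder
    (injOn_residueCoeff hx)] at h2
  refine ⟨IntegrableOn.congr_fun (Integrable.const_mul h1 _) hpt hmeas, ?_⟩
  rw [← setIntegral_congr_fun hmeas hpt, integral_const_mul, h2,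
    Fin.prod_univ_succ (fun j => Complex.Gamma (s j)), Fin.sum_univ_succ s,
    Complex.ofReal_one, Complex.one_cpow, one_mul, mul_comm]

lemma ofReal_norm_dixonAndersonIntegrand {n : ℕ} (s : Fin (n + 1) → ℂ) {x : Fin (n + 1) → ℝ}
    (hx : StrictMono x) {y : Fin n → ℝ} (hy : y ∈ interlacing x) :
    ((‖dixonAndersonIntegrand s x y‖ : ℝ) : ℂ)
      = dixonAndersonIntegrand (fun j => ((s j).re : ℂ)) x y := by
  have hne : ∀ j i, x j ≠ y i := fun j i => by
    rcases lt_or_ge i.castSucc j with h | h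
    · exact ((hy i).2.trans_le (hx.monotone (Fin.castSucc_lt_iff_succ_le.1 h))).ne'
    · exact ((hx.monotone h).trans_lt (hy i).1).ne
  simp only [dixonAndersonIntegrand, norm_mul, norm_prod, Complex.ofReal_mul]
  rw [Complex.norm_real, Real.norm_eq_abs,
    abs_of_pos (diffProd_pos (strictMono_of_mem_interlacing hx hy)), Complex.ofReal_prod]
  congr 1
  refine Finset.prod_congr rfl fun j _ => ?_
  rw [ofReal_norm_cpow (Finset.prod_pos fun i _ => abs_pos.2 (sub_ne_zero.2 (hne j i)))]
  simp

/-- The points `y` together with the endpoints of the unit interval. -/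
def withEndpoints {n : ℕ} (y : Fin n → ℝ) : Fin (n + 2) → ℝ :=
  Fin.cons 0 (Fin.snoc (α := fun _ => ℝ) y 1)

@[simp] lemma withEndpoints_zero {n : ℕ} (y : Fin n → ℝ) : withEndpoints y 0 = 0 := rfl

@[simp] lemma withEndpoints_last {n : ℕ} (y : Fin n → ℝ) :
    withEndpoints y (Fin.last n).succ = 1 := by simp [withEndpoints, -Fin.succ_last]

@[simp] lemma withEndpoints_mid {n : ℕ} (y : Fin n → ℝ) (i : Fin n) :
    withEndpoints y i.castSucc.succ = y i := by simp [withEndpoints]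

lemma strictMono_withEndpoints {n : ℕ} {y : Fin n → ℝ} (hy : y ∈ orderedSimplex n) :
    StrictMono (withEndpoints y) := by
  rw [Fin.strictMono_iff_lt_succ]
  refine Fin.lastCases ?_ fun i => ?_
  · rw [withEndpoints_last]
    cases n with
    | zero => simp
    | succ n =>
      rw [← Fin.succ_last, ← Fin.succ_castSucc, withEndpoints_mid]
      exact (hy.2 _).2
  · rw [withEndpoints_mid]
    cases n with
    | zero => exact i.elim0
    | succ n =>
      refine Fin.cases ?_ (fun j => ?_) i
      · simpa using (hy.2 0).1
      · rw [Fin.castSucc_succ, Fin.castSucc_succ, withEndpoints_mid]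
        exact hy.1 Fin.castSucc_lt_succ

lemma mem_interlacing_withEndpoints_iff {n : ℕ} {x : Fin (n + 1) → ℝ} {y : Fin n → ℝ} :
    (y ∈ orderedSimplex n ∧ x ∈ interlacing (withEndpoints y)) ↔
      (x ∈ orderedSimplex (n + 1) ∧ y ∈ interlacing x) := by
  constructor
  · rintro ⟨hy, hx⟩
    have hz := strictMono_withEndpoints hy
    refine ⟨⟨strictMono_of_mem_interlacing hz hx, fun i => ⟨?_, ?_⟩⟩, fun i => ⟨?_, ?_⟩⟩
    · have := hz.monotone (Fin.zero_le i.castSucc)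
      rw [withEndpoints_zero] at this
      exact this.trans_lt (hx i).1
    · have := hz.monotone (Fin.succ_le_succ_iff.2 (Fin.le_last i))
      rw [withEndpoints_last] at this
      exact (hx i).2.trans_le this
    · simpa using (hx i.castSucc).2
    · have := (hx i.succ).1
      rwa [Fin.castSucc_succ, withEndpoints_mid] at this
  · rintro ⟨hx, hy⟩
    refine ⟨⟨strictMono_of_mem_interlacing hx.1 hy, fun i => ⟨(hx.2 _).1.trans (hy i).1,
      (hy i).2.trans (hx.2 _).2⟩⟩, fun i => ⟨?_, ?_⟩⟩
    · refine Fin.cases ?_ (fun j => ?_) i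
      · simpa using (hx.2 0).1
      · rw [Fin.castSucc_succ, withEndpoints_mid]
        exact (hy j).2
    · refine Fin.lastCases ?_ (fun j => ?_) i
      · rw [withEndpoints_last]
        exact (hx.2 _).2
      · rw [withEndpoints_mid]
        exact (hy j).1

lemma measurableSet_orderedSimplex (n : ℕ) : MeasurableSet (orderedSimplex n) := by
  have : orderedSimplex n = (⋂ (i : Fin n) (j : Fin n) (_ : i < j), {t | t i < t j}) ∩
      ⋂ i, {t | 0 < t i ∧ t i < 1} := by
    ext t
    simp [orderedSimplex, StrictMono]
  rw [this]
  refine MeasurableSet.inter ?_ (MeasurableSet.iInter fun i => ?_)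
  · exact MeasurableSet.iInter fun i => MeasurableSet.iInter fun j => MeasurableSet.iInter fun _ =>
      measurableSet_lt (measurable_pi_apply i) (measurable_pi_apply j)
  · exact (measurableSet_lt measurable_const (measurable_pi_apply i)).inter
      (measurableSet_lt (measurable_pi_apply i) measurable_const)

lemma diffProd_withEndpoints {n : ℕ} (y : Fin n → ℝ) :
    diffProd (withEndpoints y) = (∏ i, (y i * (1 - y i))) * diffProd y := by
  rw [diffProd_succ, diffProd_castSucc, Fin.prod_univ_castSucc]
  simp only [withEndpoints_mid, withEndpoints_last, withEndpoints_zero,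
    Finset.prod_mul_distrib, sub_zero]
  ring

lemma nodeProd_withEndpoints_zero {n : ℕ} {y : Fin n → ℝ} (hy : y ∈ orderedSimplex n) :
    nodeProd (withEndpoints y) 0 = ∏ i, y i := by
  rw [nodeProd_zero, Fin.prod_univ_castSucc]
  simp only [withEndpoints_mid, withEndpoints_last, withEndpoints_zero]
  simp [abs_of_pos (hy.2 _).1]

lemma nodeProd_withEndpoints_last {n : ℕ} {y : Fin n → ℝ} (hy : y ∈ orderedSimplex n) :
    nodeProd (withEndpoints y) (Fin.last n).succ = ∏ i, (1 - y i) := by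
  rw [nodeProd_succ, nodeProd_last]
  simp only [withEndpoints_mid, withEndpoints_last, withEndpoints_zero]
  simp [abs_of_pos (sub_pos.2 (hy.2 _).2)]

lemma nodeProd_withEndpoints_mid {n : ℕ} {y : Fin n → ℝ} (hy : y ∈ orderedSimplex n) (i : Fin n) :
    nodeProd (withEndpoints y) i.castSucc.succ = y i * (1 - y i) * nodeProd y i := by
  rw [nodeProd_succ, nodeProd_castSucc]
  simp only [withEndpoints_mid, withEndpoints_last, withEndpoints_zero]
  rw [abs_sub_comm _ (1 : ℝ), abs_of_pos (sub_pos.2 (hy.2 _).2), sub_zero,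
    abs_of_pos (hy.2 _).1]
  ring

lemma rpow_mul_rpow_neg_le {d D A s u v : ℝ} (hd : 0 ≤ d) (hd1 : d ≤ 1) (hdD : d ≤ D) (hdA : d ≤ A)
    (hs : 0 ≤ s) (hu : 0 < u) (hv : 0 < v) (hsuv : s ≤ u + v) :
    s ^ d * u ^ (-A) * v ^ (-D) ≤ 2 * (u ^ (-(A + D - d)) + v ^ (-(A + D - d))) := by
  have h2 : ∀ w : ℝ, 0 < w → s ≤ 2 * w → s ^ d ≤ 2 * w ^ d := fun w hw h =>
    calc s ^ d ≤ (2 * w) ^ d := Real.rpow_le_rpow hs h hd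
      _ = 2 ^ d * w ^ d := Real.mul_rpow (by norm_num) hw.le
      _ ≤ 2 * w ^ d := by
        gcongr
        simpa using Real.rpow_le_rpow_of_exponent_le (x := 2) (by norm_num) hd1
  have hu' := Real.rpow_pos_of_pos hu (-(A + D - d))
  have hv' := Real.rpow_pos_of_pos hv (-(A + D - d))
  rcases le_total u v with h | h
  · calc s ^ d * u ^ (-A) * v ^ (-D) ≤ 2 * v ^ d * u ^ (-A) * v ^ (-D) := by
          gcongr; exact h2 v hv (by linarith)
      _ = 2 * (u ^ (-A) * v ^ (-(D - d))) := by
          rw [show -(D - d) = d + -D by ring, Real.rpow_add hv]; ring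
      _ ≤ 2 * (u ^ (-A) * u ^ (-(D - d))) := by
          gcongr 2 * (_ * ?_)
          exact Real.rpow_le_rpow_of_nonpos hu h (by linarith)
      _ = 2 * u ^ (-(A + D - d)) := by
          rw [← Real.rpow_add hu]; ring_nf
      _ ≤ _ := by linarith
  · calc s ^ d * u ^ (-A) * v ^ (-D) ≤ 2 * u ^ d * u ^ (-A) * v ^ (-D) := by
          gcongr; exact h2 u hu (by linarith)
      _ = 2 * (u ^ (-(A - d)) * v ^ (-D)) := by
          rw [show -(A - d) = d + -A by ring, Real.rpow_add hu]; ring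
      _ ≤ 2 * (v ^ (-(A - d)) * v ^ (-D)) := by
          gcongr 2 * (?_ * _)
          exact Real.rpow_le_rpow_of_nonpos hv h (by linarith)
      _ = 2 * v ^ (-(A + D - d)) := by
          rw [← Real.rpow_add hv]; ring_nf
      _ ≤ _ := by linarith

lemma rpow_mul_weight_le_of_le_half {d D A s t v : ℝ} (hd : 0 ≤ d) (hd1 : d ≤ 1) (hdD : d ≤ D)
    (hdA : d ≤ A) (hA : A ≤ 1) (hs : s ∈ Set.Ioo (0 : ℝ) 1) (ht0 : 0 < t) (ht : t ≤ 1 / 2)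
    (hv : 0 < v) (hsv : s ≤ t + v) :
    (s * (1 - s)) ^ d * ((t * (1 - t)) ^ (-A) * v ^ (-D)) ≤
      4 * (t ^ (-(A + D - d)) + v ^ (-(A + D - d))) := by
  have hs1 : 0 < 1 - s := sub_pos.2 hs.2
  have h1 : (s * (1 - s)) ^ d ≤ s ^ d :=
    Real.rpow_le_rpow (mul_pos hs.1 hs1).le (by nlinarith [hs.1]) hd
  have h2 : (1 - t) ^ (-A) ≤ 2 :=
    calc (1 - t) ^ (-A) ≤ (1 / 2 : ℝ) ^ (-A) :=
          Real.rpow_le_rpow_of_nonpos (by norm_num) (by linarith) (by linarith)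
      _ = 2 ^ A := by
        rw [one_div, Real.inv_rpow (by norm_num), Real.rpow_neg (by norm_num), inv_inv]
      _ ≤ 2 := by simpa using Real.rpow_le_rpow_of_exponent_le (x := 2) (by norm_num) hA
  rw [Real.mul_rpow ht0.le (by linarith)]
  have hs0 := hs.1.le
  have ht1 : 0 ≤ 1 - t := by linarith
  calc (s * (1 - s)) ^ d * (t ^ (-A) * (1 - t) ^ (-A) * v ^ (-D))
      ≤ s ^ d * (t ^ (-A) * 2 * v ^ (-D)) := by gcongr
    _ = 2 * (s ^ d * t ^ (-A) * v ^ (-D)) := by ring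
    _ ≤ 2 * (2 * (t ^ (-(A + D - d)) + v ^ (-(A + D - d)))) := by
        gcongr 2 * ?_; exact rpow_mul_rpow_neg_le hd hd1 hdD hdA hs.1.le ht0 hv hsv
    _ = _ := by ring

lemma rpow_mul_weight_le {d D A s t : ℝ} (hd : 0 ≤ d) (hd1 : d ≤ 1) (hdD : d ≤ D)
    (hdA : d ≤ A) (hA : A ≤ 1) (hs : s ∈ Set.Ioo (0 : ℝ) 1) (ht : t ∈ Set.Ioo (0 : ℝ) 1)
    (hst : t ≠ s) :
    (s * (1 - s)) ^ d * ((t * (1 - t)) ^ (-A) * |s - t| ^ (-D)) ≤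
      4 * (t ^ (-(A + D - d)) + (1 - t) ^ (-(A + D - d)) + |t - s| ^ (-(A + D - d))) := by
  have hv : 0 < |t - s| := abs_pos.2 (sub_ne_zero.2 hst)
  have h1 := Real.rpow_pos_of_pos ht.1 (-(A + D - d))
  have h2 := Real.rpow_pos_of_pos (sub_pos.2 ht.2) (-(A + D - d))
  rw [abs_sub_comm s t]
  rcases le_total t (1 / 2) with h | h
  · have := rpow_mul_weight_le_of_le_half hd hd1 hdD hdA hA hs ht.1 h hv
      (by linarith [neg_abs_le (t - s)])
    linarith
  · have := rpow_mul_weight_le_of_le_half (s := 1 - s) (t := 1 - t) hd hd1 hdD hdA hA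
      ⟨sub_pos.2 hs.2, by linarith [hs.1]⟩ (sub_pos.2 ht.2) (by linarith) hv
      (by linarith [le_abs_self (t - s)])
    rw [sub_sub_cancel, sub_sub_cancel, mul_comm (1 - s), mul_comm (1 - t)] at this
    linarith

lemma intervalIntegrable_abs_rpow {e : ℝ} (he : e < 1) :
    IntervalIntegrable (fun u : ℝ => |u| ^ (-e)) volume (-1) 1 := by
  have h1 : IntervalIntegrable (fun u : ℝ => |u| ^ (-e)) volume 0 1 := by
    refine (intervalIntegral.intervalIntegrable_rpow' (r := -e) (by linarith)).congr fun u hu => ?_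
    rw [Set.uIoc_of_le zero_le_one] at hu
    simp only [abs_of_pos hu.1]
  have h2 := (intervalIntegrable_iff.2 (intervalIntegrable_iff.1 h1)).comp_mul_left (c := -1)
  simp only [neg_mul, one_mul, abs_neg, zero_div] at h2
  norm_num at h2
  exact h2.symm.trans h1

lemma exists_integral_weight_le {e : ℝ} (he : e < 1) :
    ∃ K : ℝ, ∀ s ∈ Set.Ioo (0 : ℝ) 1,
      IntegrableOn (fun t : ℝ => 4 * (t ^ (-e) + (1 - t) ^ (-e) + |t - s| ^ (-e))) (Set.Ioo 0 1) ∧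
      ∫ t in Set.Ioo 0 1, 4 * (t ^ (-e) + (1 - t) ^ (-e) + |t - s| ^ (-e)) ≤ K := by
  have h1 : IntervalIntegrable (fun t : ℝ => t ^ (-e)) volume 0 1 :=
    intervalIntegral.intervalIntegrable_rpow' (by linarith)
  have h2 : IntervalIntegrable (fun t : ℝ => (1 - t) ^ (-e)) volume 0 1 := by
    have := (h1.comp_sub_left 1).symm
    simpa using this
  have h3 := intervalIntegrable_abs_rpow he
  refine ⟨4 * ((∫ t in (0 : ℝ)..1, t ^ (-e)) + (∫ t in (0 : ℝ)..1, (1 - t) ^ (-e)) +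
    ∫ u in (-1 : ℝ)..1, |u| ^ (-e)), fun s hs => ?_⟩
  have hsub : Set.uIcc (0 - s) (1 - s) ⊆ Set.uIcc (-1) 1 := by
    rw [Set.uIcc_of_le (by linarith), Set.uIcc_of_le (by norm_num)]
    exact Set.Icc_subset_Icc (by linarith [hs.2]) (by linarith [hs.1])
  have h4 : IntervalIntegrable (fun t : ℝ => |t - s| ^ (-e)) volume 0 1 := by
    have := (h3.mono_set hsub).comp_sub_right s
    simpa using this
  have h5 := ((h1.add h2).add h4).const_mul 4
  refine ⟨(intervalIntegrable_iff_integrableOn_Ioo_of_le zero_le_one).1 h5, ?_⟩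
  rw [← integral_Ioc_eq_integral_Ioo, ← intervalIntegral.integral_of_le zero_le_one,
    intervalIntegral.integral_const_mul, intervalIntegral.integral_add (h1.add h2) h4,
    intervalIntegral.integral_add h1 h2,
    intervalIntegral.integral_comp_sub_right (fun u => |u| ^ (-e)) s]
  gcongr
  exact intervalIntegral.integral_mono_interval (by linarith [hs.2]) (by linarith)
    (by linarith [hs.1]) (Filter.Eventually.of_forall fun u => by positivity) h3

lemma integrableOn_weight {A : ℝ} (hA : A < 1) :
    IntegrableOn (fun s : ℝ => (s * (1 - s)) ^ (-A)) (Set.Ioo 0 1) := by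
  have h := integrableOn_beta (u := ((1 - A : ℝ) : ℂ)) (v := ((1 - A : ℝ) : ℂ))
    (by simpa) (by simpa) one_pos
  refine IntegrableOn.congr_fun (Integrable.norm h) (fun s hs => ?_) measurableSet_Ioo
  simp only [norm_mul]
  rw [Complex.norm_cpow_eq_rpow_re_of_pos hs.1,
    Complex.norm_cpow_eq_rpow_re_of_pos (sub_pos.2 hs.2),
    Real.mul_rpow hs.1.le (sub_pos.2 hs.2).le]
  simp

/-- The unit cube. -/
def unitCube (n : ℕ) : Set (Fin n → ℝ) := Set.univ.pi fun _ => Set.Ioo 0 1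

lemma measurableSet_unitCube (n : ℕ) : MeasurableSet (unitCube n) :=
  MeasurableSet.univ_pi fun _ => measurableSet_Ioo

lemma indicator_unitCube_prod {n : ℕ} (h : ℝ → ℝ) (t : Fin n → ℝ) :
    (unitCube n).indicator (fun t => ∏ i, h (t i)) t
      = ∏ i, (Set.Ioo (0 : ℝ) 1).indicator h (t i) := by
  by_cases ht : t ∈ unitCube n
  · rw [Set.indicator_of_mem ht]
    exact Finset.prod_congr rfl fun i _ => (Set.indicator_of_mem (ht i trivial) h).symm
  · rw [Set.indicator_of_notMem ht]
    simp only [unitCube, Set.mem_pi, not_forall] at ht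
    obtain ⟨i, -, hi⟩ := ht
    exact (Finset.prod_eq_zero (Finset.mem_univ i) (Set.indicator_of_notMem hi h)).symm

lemma integrableOn_weight_abs_sub {d D A : ℝ} (hd : 0 ≤ d) (hd1 : d ≤ 1) (hdD : d ≤ D)
    (hdA : d ≤ A) (hA : A ≤ 1) (he : A + D - d < 1) :
    ∃ K : ℝ, ∀ s ∈ Set.Ioo (0 : ℝ) 1,
      IntegrableOn (fun t : ℝ => (t * (1 - t)) ^ (-A) * |s - t| ^ (-D)) (Set.Ioo 0 1) ∧
      ∫ t in Set.Ioo 0 1, (t * (1 - t)) ^ (-A) * |s - t| ^ (-D) ≤ K * (s * (1 - s)) ^ (-d) := by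
  obtain ⟨K, hK⟩ := exists_integral_weight_le he
  refine ⟨K, fun s hs => ?_⟩
  have hpos : 0 < s * (1 - s) := mul_pos hs.1 (sub_pos.2 hs.2)
  have hle : ∀ᵐ t ∂volume.restrict (Set.Ioo 0 1), (t * (1 - t)) ^ (-A) * |s - t| ^ (-D) ≤
      (s * (1 - s)) ^ (-d) *
        (4 * (t ^ (-(A + D - d)) + (1 - t) ^ (-(A + D - d)) + |t - s| ^ (-(A + D - d)))) := by
    filter_upwards [ae_restrict_mem measurableSet_Ioo,
      ae_restrict_of_ae (Measure.ae_ne volume s)] with t ht hts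
    have := rpow_mul_weight_le hd hd1 hdD hdA hA hs ht hts
    rwa [Real.rpow_neg hpos.le, ← div_eq_inv_mul, le_div_iff₀' (Real.rpow_pos_of_pos hpos d)]
  have hint := Integrable.const_mul (hK s hs).1 ((s * (1 - s)) ^ (-d))
  have h1 : IntegrableOn (fun t : ℝ => (t * (1 - t)) ^ (-A) * |s - t| ^ (-D)) (Set.Ioo 0 1) := by
    refine Integrable.mono' hint (by fun_prop) ?_
    filter_upwards [hle, ae_restrict_mem measurableSet_Ioo] with t ht htm
    rwa [Real.norm_of_nonneg]
    have := mul_pos htm.1 (sub_pos.2 htm.2)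
    positivity
  refine ⟨h1, (integral_mono_ae h1 hint hle).trans ?_⟩
  rw [integral_const_mul, mul_comm]
  gcongr
  exact (hK s hs).2

/-- The majorant of the Selberg integrand that singles out the point `t_j`. -/
noncomputable def nodeWeight {n : ℕ} (A D : ℝ) (j : Fin n) (t : Fin n → ℝ) : ℝ :=
  (∏ i, (t i * (1 - t i)) ^ (-A)) * nodeProd t j ^ (-D)

lemma integrableOn_nodeWeight {n : ℕ} {d D A : ℝ} (hd : 0 ≤ d) (hd1 : d ≤ 1) (hdD : d ≤ D)
    (hdA : d ≤ A) (hA : A ≤ 1) (he : A + D - d < 1) (hn : A + n * d < 1) (j : Fin (n + 1)) :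
    IntegrableOn (nodeWeight A D j) (unitCube (n + 1)) := by
  obtain ⟨K, hK⟩ := integrableOn_weight_abs_sub hd hd1 hdD hdA hA he
  set e := MeasurableEquiv.piFinSuccAbove (fun _ : Fin (n + 1) => ℝ) j
  have hmp : MeasurePreserving e.symm :=
    (volume_preserving_piFinSuccAbove (fun _ : Fin (n + 1) => ℝ) j).symm
  have he0 : ∀ p, e.symm p j = p.1 := fun p => by
    simp [e, MeasurableEquiv.piFinSuccAbove, Fin.insertNthEquiv]
  have hes : ∀ p, ∀ i : Fin n, e.symm p (j.succAbove i) = p.2 i := fun p i => by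
    simp [e, MeasurableEquiv.piFinSuccAbove, Fin.insertNthEquiv]
  set I := Set.Ioo (0 : ℝ) 1
  set w : ℝ → ℝ := fun s => (s * (1 - s)) ^ (-A)
  set h : ℝ → ℝ → ℝ := fun s t => (t * (1 - t)) ^ (-A) * |s - t| ^ (-D) with hh
  have hnonneg : ∀ s, ∀ t, 0 ≤ I.indicator (h s) t := fun s t =>
    Set.indicator_nonneg (fun t ht => by
      have := mul_pos ht.1 (sub_pos.2 ht.2)
      simp only [hh]
      positivity) t
  have hcube : ∀ p, e.symm p ∈ unitCube (n + 1) ↔ p.1 ∈ I ∧ p.2 ∈ unitCube n := fun p => by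
    simp only [unitCube, Set.mem_univ_pi]
    rw [Fin.forall_iff_succAbove j]
    simp only [he0, hes]
    rfl
  have hfac : ∀ p, (unitCube (n + 1)).indicator (nodeWeight A D j) (e.symm p)
      = I.indicator w p.1 * ∏ i, I.indicator (h p.1) (p.2 i) := by
    intro p
    rw [← indicator_unitCube_prod]
    by_cases hp : e.symm p ∈ unitCube (n + 1)
    · have hp' := (hcube p).1 hp
      rw [Set.indicator_of_mem hp, Set.indicator_of_mem hp'.1, Set.indicator_of_mem hp'.2,
        nodeWeight, Fin.prod_univ_succAbove _ j, nodeProd_eq_succAbove,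
        ← Real.finsetProd_rpow _ _ (fun i _ => abs_nonneg _)]
      simp only [he0, hes, hh, Finset.prod_mul_distrib, w]
      ring
    · rw [Set.indicator_of_notMem hp]
      rcases not_and_or.1 (fun H => hp ((hcube p).2 H)) with H | H
      · rw [Set.indicator_of_notMem H, zero_mul]
      · rw [Set.indicator_of_notMem H, mul_zero]
  have hcubem := measurableSet_unitCube (n + 1)
  have hmeas : Measurable (nodeWeight A D j) := by
    unfold nodeWeight nodeProd; fun_prop
  rw [← integrable_indicator_iff hcubem, ← hmp.integrable_comp_emb e.symm.measurableEmbedding]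
  have hcomp : Measurable ((unitCube (n + 1)).indicator (nodeWeight A D j) ∘ e.symm) :=
    (hmeas.indicator hcubem).comp e.symm.measurable
  have heq : (unitCube (n + 1)).indicator (nodeWeight A D j) ∘ e.symm =
      fun p => I.indicator w p.1 * ∏ i, I.indicator (h p.1) (p.2 i) := funext hfac
  have hwI : ∀ s ∉ I, I.indicator w s = 0 := fun s hs => Set.indicator_of_notMem hs w
  rw [heq] at hcomp ⊢
  rw [Measure.volume_eq_prod, integrable_prod_iff hcomp.aestronglyMeasurable]
  have hsec : ∀ s ∈ I, Integrable (I.indicator (h s)) := fun s hs =>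
    (integrable_indicator_iff measurableSet_Ioo).2 (hK s hs).1
  constructor
  · refine Filter.Eventually.of_forall fun s => ?_
    by_cases hs : s ∈ I
    · have : Integrable (fun y : Fin n → ℝ => ∏ i, I.indicator (h s) (y i)) :=
        Integrable.fintype_prod fun _ => hsec s hs
      exact this.const_mul (I.indicator w s)
    · simp [hwI s hs]
  · have hb : Integrable (I.indicator fun s => K ^ n * (s * (1 - s)) ^ (-(A + n * d))) :=
      (integrable_indicator_iff measurableSet_Ioo).2
        (Integrable.const_mul (integrableOn_weight hn) _)
    refine hb.mono' ?_ (Filter.Eventually.of_forall fun s => ?_)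
    · exact (hcomp.norm.stronglyMeasurable.integral_prod_right (ν := volume)).aestronglyMeasurable
    · rw [Real.norm_of_nonneg (integral_nonneg fun _ => norm_nonneg _)]
      by_cases hs : s ∈ I
      · have hpos : 0 < s * (1 - s) := mul_pos hs.1 (sub_pos.2 hs.2)
        have hnorm : ∀ y : Fin n → ℝ, ‖I.indicator w s * ∏ i, I.indicator (h s) (y i)‖
            = w s * ∏ i, I.indicator (h s) (y i) := fun y => by
          rw [Set.indicator_of_mem hs, Real.norm_of_nonneg]
          exact mul_nonneg (Real.rpow_nonneg hpos.le _) (Finset.prod_nonneg fun i _ => hnonneg s _)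
        simp only [hnorm]
        rw [integral_const_mul, integral_fintype_prod_volume_eq_pow, Fintype.card_fin,
          Set.indicator_of_mem hs, integral_indicator measurableSet_Ioo]
        calc w s * (∫ t in I, h s t) ^ n
            ≤ w s * (K * (s * (1 - s)) ^ (-d)) ^ n := by
              have h0 : 0 ≤ ∫ t in I, h s t := by
                rw [← integral_indicator measurableSet_Ioo]
                exact integral_nonneg fun t => hnonneg s t
              have := (hK s hs).2
              have hw : 0 ≤ w s := Real.rpow_nonneg hpos.le _
              gcongr
          _ = _ := by
              rw [mul_pow, ← Real.rpow_mul_natCast hpos.le, mul_left_comm,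
                ← Real.rpow_add hpos]
              ring_nf
      · simp [hwI s hs, Set.indicator_of_notMem hs]

lemma diffProd_le_one {n : ℕ} {t : Fin n → ℝ} (ht : t ∈ orderedSimplex n) : diffProd t ≤ 1 := by
  have h : ∀ i, ∀ j ∈ Finset.Ioi i, 0 ≤ t j - t i ∧ t j - t i ≤ 1 := fun i j hj =>
    ⟨sub_nonneg.2 (ht.1 (Finset.mem_Ioi.1 hj)).le, by linarith [(ht.2 i).1, (ht.2 j).2]⟩
  exact Finset.prod_le_one (fun i _ => Finset.prod_nonneg fun j hj => (h i j hj).1)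
    fun i _ => Finset.prod_le_one (fun j hj => (h i j hj).1) fun j hj => (h i j hj).2

lemma norm_selbergIntegrand {n : ℕ} (α β γ : ℂ) {t : Fin n → ℝ} (ht : t ∈ orderedSimplex n) :
    ‖selbergIntegrand n α β γ t‖ =
      (∏ i, t i ^ (α.re - 1) * (1 - t i) ^ (β.re - 1)) * diffProd t ^ (2 * γ.re) := by
  rw [selbergIntegrand_eq α β γ ht, norm_mul, betaWeight, norm_prod,
    Complex.norm_cpow_eq_rpow_re_of_pos (diffProd_pos ht.1)]
  congr 1
  · refine Finset.prod_congr rfl fun i _ => ?_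
    rw [norm_mul, Complex.norm_cpow_eq_rpow_re_of_pos (ht.2 i).1,
      Complex.norm_cpow_eq_rpow_re_of_pos (sub_pos.2 (ht.2 i).2)]
    simp
  · simp

lemma measurable_selbergIntegrand (n : ℕ) (α β γ : ℂ) : Measurable (selbergIntegrand n α β γ) := by
  unfold selbergIntegrand; fun_prop

lemma diffProd_rpow_neg_le_sum {n : ℕ} {t : Fin (n + 1) → ℝ} (ht : StrictMono t) (d : ℝ) :
    diffProd t ^ (-(2 * d)) ≤ ∑ j, nodeProd t j ^ (-((n + 1) * d)) := by
  have hpos := nodeProd_pos ht.injective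
  obtain ⟨j, -, hj⟩ := Finset.exists_max_image Finset.univ (fun j => nodeProd t j ^ (-d))
    Finset.univ_nonempty
  calc diffProd t ^ (-(2 * d)) = (∏ j, nodeProd t j) ^ (-d) := by
        rw [prod_nodeProd, ← Real.rpow_natCast_mul (diffProd_pos ht).le]
        congr 1; push_cast; ring
    _ = ∏ i, nodeProd t i ^ (-d) := (Real.finsetProd_rpow _ _ (fun i _ => (hpos i).le) _).symm
    _ ≤ ∏ _i : Fin (n + 1), nodeProd t j ^ (-d) :=
        Finset.prod_le_prod (fun i _ => Real.rpow_nonneg (hpos i).le _) hj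
    _ = nodeProd t j ^ (-((n + 1) * d)) := by
        rw [Finset.prod_const, Finset.card_univ, Fintype.card_fin,
          ← Real.rpow_mul_natCast (hpos j).le]
        congr 1; push_cast; ring
    _ ≤ _ := Finset.single_le_sum (f := fun j => nodeProd t j ^ (-((n + 1) * d)))
        (fun i _ => Real.rpow_nonneg (hpos i).le _) (Finset.mem_univ j)

theorem integrableOn_selbergIntegrand {n : ℕ} {α β γ : ℂ} (hα : 0 < α.re) (hβ : 0 < β.re)
    (hγ : 0 < 1 + (n + 1) * γ.re) (hαγ : 0 < α.re + n * γ.re) (hβγ : 0 < β.re + n * γ.re) :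
    IntegrableOn (selbergIntegrand (n + 1) α β γ) (orderedSimplex (n + 1)) := by
  set d := max 0 (-γ.re) with hd
  set A := max d (max (1 - α.re) (1 - β.re)) with hA
  have hd0 : 0 ≤ d := le_max_left _ _
  have hdγ : -γ.re ≤ d := le_max_right _ _
  have hn : (0 : ℝ) ≤ n := n.cast_nonneg
  have hd' : (n + 1) * d < 1 := by
    rcases max_choice 0 (-γ.re) with h | h <;> rw [hd, h] <;> linarith
  have hnd : n * d < α.re ∧ n * d < β.re := by
    rcases max_choice 0 (-γ.re) with h | h <;> rw [hd, h] <;> constructor <;> linarith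
  have hdD : d ≤ (n + 1) * d := by nlinarith
  have hdA : d ≤ A := le_max_left _ _
  have hαA : -A ≤ α.re - 1 := by
    linarith [(le_max_left (1 - α.re) (1 - β.re)).trans (le_max_right d _)]
  have hβA : -A ≤ β.re - 1 := by
    linarith [(le_max_right (1 - α.re) (1 - β.re)).trans (le_max_right d _)]
  have hAn : A + n * d < 1 := by
    rcases max_choice d (max (1 - α.re) (1 - β.re)) with h | h
    · rw [hA, h]; linarith
    · rcases max_choice (1 - α.re) (1 - β.re) with h' | h' <;> rw [hA, h, h'] <;> linarith
  have hA1 : A ≤ 1 := by nlinarith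
  have hsub : orderedSimplex (n + 1) ⊆ unitCube (n + 1) := fun t ht i _ => ht.2 i
  have hint : IntegrableOn (fun t => ∑ j : Fin (n + 1), nodeWeight A ((n + 1) * d) j t)
      (orderedSimplex (n + 1)) :=
    (integrable_finsetSum _ fun j _ => integrableOn_nodeWeight hd0 (by linarith) hdD hdA hA1
      (by linarith) hAn j).mono_measure (Measure.restrict_mono hsub le_rfl)
  refine Integrable.mono' hint (measurable_selbergIntegrand _ _ _ _).aestronglyMeasurable ?_
  filter_upwards [ae_restrict_mem (measurableSet_orderedSimplex _)] with t ht
  rw [norm_selbergIntegrand α β γ ht]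
  have h0 : ∀ i, 0 < t i := fun i => (ht.2 i).1
  have h1 : ∀ i, 0 < 1 - t i := fun i => sub_pos.2 (ht.2 i).2
  simp only [nodeWeight]
  rw [← Finset.mul_sum]
  have hD := diffProd_pos ht.1
  refine mul_le_mul (Finset.prod_le_prod (fun i _ => ?_) fun i _ => ?_) ?_
    (by positivity) (Finset.prod_nonneg fun i _ => ?_)
  · have := h0 i; have := h1 i; positivity
  · rw [Real.mul_rpow (h0 i).le (h1 i).le]
    have := h0 i; have := h1 i
    gcongr ?_ * ?_
    · exact Real.rpow_le_rpow_of_exponent_ge (h0 i) (ht.2 i).2.le hαA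
    · exact Real.rpow_le_rpow_of_exponent_ge (h1 i) (by linarith) hβA
  · exact (Real.rpow_le_rpow_of_exponent_ge hD (diffProd_le_one ht) (by linarith)).trans
      (diffProd_rpow_neg_le_sum ht.1 d)
  · have := h0 i; have := h1 i; positivity

lemma setIntegral_sections_symm {X Y : Type*} [MeasureSpace X] [MeasureSpace Y]
    [SFinite (volume : Measure X)] [SFinite (volume : Measure Y)]
    {f : X × Y → ℂ} {S : Set Y} {T : Y → Set X} {R : Set (X × Y)}
    (hRmem : ∀ x y, (x, y) ∈ R ↔ y ∈ S ∧ x ∈ T y)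
    (hS : MeasurableSet S) (hT : ∀ y ∈ S, MeasurableSet (T y)) (hR : MeasurableSet R)
    (hf : IntegrableOn f R) :
    ∫ p in R, f p = ∫ y in S, ∫ x in T y, f (x, y) := by
  rw [← integral_indicator hR, Measure.volume_eq_prod, integral_prod_symm _
    (by rw [← Measure.volume_eq_prod]; exact (integrable_indicator_iff hR).2 hf),
    ← integral_indicator hS]
  congr 1
  funext y
  by_cases hy : y ∈ S
  · rw [Set.indicator_of_mem hy, ← integral_indicator (hT y hy)]
    congr 1
    funext x
    by_cases hx : x ∈ T y
    · rw [Set.indicator_of_mem ((hRmem x y).2 ⟨hy, hx⟩), Set.indicator_of_mem hx]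
    · rw [Set.indicator_of_notMem (fun h => hx ((hRmem x y).1 h).2), Set.indicator_of_notMem hx]
  · rw [Set.indicator_of_notMem hy]
    exact integral_eq_zero_of_ae (Filter.Eventually.of_forall fun x =>
      Set.indicator_of_notMem (fun h => hy ((hRmem x y).1 h).1) f)

/-- The integrand, over pairs of interlacing point configurations in the unit interval, that
links the Selberg integrals in `n + 1` and in `n` variables. -/
noncomputable def interlacingIntegrand {n : ℕ} (α β γ : ℂ)
    (p : (Fin (n + 1) → ℝ) × (Fin n → ℝ)) : ℂ :=
  betaWeight α β p.1 * (diffProd p.1 : ℂ) * dixonAndersonIntegrand (fun _ => γ) p.1 p.2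

/-- The pairs of interlacing point configurations in the unit interval. -/
def interlacingPairs (n : ℕ) : Set ((Fin (n + 1) → ℝ) × (Fin n → ℝ)) :=
  {p | p.1 ∈ orderedSimplex (n + 1) ∧ p.2 ∈ interlacing p.1}

lemma measurableSet_interlacingPairs (n : ℕ) : MeasurableSet (interlacingPairs n) := by
  have : interlacingPairs n = Prod.fst ⁻¹' orderedSimplex (n + 1) ∩
      ⋂ i : Fin n, {p : (Fin (n + 1) → ℝ) × (Fin n → ℝ) |
        p.1 i.castSucc < p.2 i ∧ p.2 i < p.1 i.succ} := by
    ext p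
    simp [interlacingPairs, interlacing]
  rw [this]
  refine (measurable_fst (measurableSet_orderedSimplex _)).inter (MeasurableSet.iInter fun i => ?_)
  have h1 : ∀ j, Measurable fun p : (Fin (n + 1) → ℝ) × (Fin n → ℝ) => p.1 j := by fun_prop
  have h2 : Measurable fun p : (Fin (n + 1) → ℝ) × (Fin n → ℝ) => p.2 i := by fun_prop
  exact (measurableSet_lt (h1 _) h2).inter (measurableSet_lt h2 (h1 _))

lemma measurable_interlacingIntegrand {n : ℕ} (α β γ : ℂ) :
    Measurable (interlacingIntegrand (n := n) α β γ) := by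
  unfold interlacingIntegrand betaWeight dixonAndersonIntegrand diffProd
  fun_prop

lemma ofReal_norm_interlacingIntegrand {n : ℕ} (α β γ : ℂ) {x : Fin (n + 1) → ℝ} {y : Fin n → ℝ}
    (hx : x ∈ orderedSimplex (n + 1)) (hy : y ∈ interlacing x) :
    ((‖interlacingIntegrand α β γ (x, y)‖ : ℝ) : ℂ) =
      interlacingIntegrand (α.re : ℂ) (β.re : ℂ) (γ.re : ℂ) (x, y) := by
  simp only [interlacingIntegrand, norm_mul, Complex.ofReal_mul]
  rw [ofReal_norm_dixonAndersonIntegrand _ hx.1 hy, Complex.norm_real,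
    Real.norm_of_nonneg (diffProd_pos hx.1).le]
  congr 2
  simp only [betaWeight, norm_prod, norm_mul, Complex.ofReal_prod, Complex.ofReal_mul]
  refine Finset.prod_congr rfl fun i _ => ?_
  rw [ofReal_norm_cpow (hx.2 i).1,
    ofReal_norm_cpow (sub_pos.2 (hx.2 i).2)]
  simp

lemma sq_mul_cpow_sub_one {r : ℝ} (hr : 0 < r) (γ : ℂ) :
    (r : ℂ) ^ 2 * ((r ^ 2 : ℝ) : ℂ) ^ (γ - 1) = (r : ℂ) ^ (2 * γ) := by
  have hr0 : (r : ℂ) ≠ 0 := Complex.ofReal_ne_zero.2 hr.ne'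
  rw [sq r, Complex.ofReal_mul, Complex.mul_cpow_ofReal_nonneg hr.le hr.le,
    ← Complex.cpow_add _ _ hr0, ← Complex.cpow_natCast, ← Complex.cpow_add _ _ hr0]
  congr 1; push_cast; ring

lemma interlacingIntegrand_integral_snd {n : ℕ} (α β : ℂ) {γ : ℂ} (hγ : 0 < γ.re)
    {x : Fin (n + 1) → ℝ} (hx : x ∈ orderedSimplex (n + 1)) :
    IntegrableOn (fun y => interlacingIntegrand α β γ (x, y)) (interlacing x) ∧
      ∫ y in interlacing x, interlacingIntegrand α β γ (x, y) =
        Complex.Gamma γ ^ (n + 1) / Complex.Gamma ((n + 1) * γ) *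
          selbergIntegrand (n + 1) α β γ x := by
  obtain ⟨h1, h2⟩ := dixon_anderson_integral (s := fun _ : Fin (n + 1) => γ) (fun _ => hγ) hx.1
  refine ⟨Integrable.const_mul h1 (betaWeight α β x * diffProd x), ?_⟩
  simp only [interlacingIntegrand]
  rw [integral_const_mul, h2, selbergIntegrand_eq α β γ hx,
    ← ofReal_prod_cpow _ (fun i _ => (nodeProd_pos hx.1.injective i).le), prod_nodeProd,
    ← sq_mul_cpow_sub_one (diffProd_pos hx.1)]
  simp
  ring

/-- The exponents attached to the points `withEndpoints y`. -/
def endpointExponents (n : ℕ) (α β γ : ℂ) : Fin (n + 2) → ℂ :=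
  Fin.cons α (Fin.snoc (α := fun _ => ℂ) (fun _ : Fin n => γ) β)

lemma prod_univ_endpointExponents {M : Type*} [CommMonoid M] {n : ℕ} (α β γ : ℂ)
    (g : Fin (n + 2) → ℂ → M) :
    ∏ j, g j (endpointExponents n α β γ j)
      = g 0 α * ((∏ i : Fin n, g i.castSucc.succ γ) * g (Fin.last n).succ β) := by
  rw [Fin.prod_univ_succ, Fin.prod_univ_castSucc]
  simp [endpointExponents, -Fin.succ_last]

lemma interlacingIntegrand_eq {n : ℕ} (α β γ : ℂ) {x : Fin (n + 1) → ℝ} {y : Fin n → ℝ}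
    (hx : x ∈ orderedSimplex (n + 1)) :
    interlacingIntegrand α β γ (x, y) = (diffProd y : ℂ) *
      dixonAndersonIntegrand (endpointExponents n α β γ) (withEndpoints y) x := by
  have h1 : betaWeight α β x =
      ((∏ i, |0 - x i| : ℝ) : ℂ) ^ (α - 1) * ((∏ i, |1 - x i| : ℝ) : ℂ) ^ (β - 1) := by
    rw [betaWeight, ofReal_prod_cpow _ (fun _ _ => abs_nonneg _),
      ofReal_prod_cpow _ (fun _ _ => abs_nonneg _), ← Finset.prod_mul_distrib]
    refine Finset.prod_congr rfl fun i _ => ?_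
    rw [zero_sub, abs_neg, abs_of_pos (hx.2 i).1, abs_of_pos (sub_pos.2 (hx.2 i).2)]
  have h2 : ∏ j, ((∏ i, |x j - y i| : ℝ) : ℂ) ^ (γ - 1)
      = ∏ i, ((∏ j, |y i - x j| : ℝ) : ℂ) ^ (γ - 1) := by
    rw [← ofReal_prod_cpow _ (fun _ _ => Finset.prod_nonneg fun _ _ => abs_nonneg _),
      ← ofReal_prod_cpow _ (fun _ _ => Finset.prod_nonneg fun _ _ => abs_nonneg _),
      Finset.prod_comm]
    simp only [abs_sub_comm]
  simp only [interlacingIntegrand, dixonAndersonIntegrand]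
  rw [prod_univ_endpointExponents α β γ
    (fun j z => ((∏ i, |withEndpoints y j - x i| : ℝ) : ℂ) ^ (z - 1)), h1, h2]
  simp only [withEndpoints_mid, withEndpoints_last, withEndpoints_zero]
  ring

lemma diffProd_mul_prod_nodeProd_withEndpoints {n : ℕ} (α β γ : ℂ) {y : Fin n → ℝ}
    (hy : y ∈ orderedSimplex n) :
    (diffProd y : ℂ) * ((diffProd (withEndpoints y) : ℂ) *
      ∏ j, (nodeProd (withEndpoints y) j : ℂ) ^ (endpointExponents n α β γ j - 1)) =
      selbergIntegrand n (α + γ) (β + γ) γ y := by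
  have hnode : ∀ i, 0 ≤ nodeProd y i := fun i => (nodeProd_pos hy.1.injective i).le
  have h0 : ∀ i, 0 < y i := fun i => (hy.2 i).1
  have h1 : ∀ i, 0 < 1 - y i := fun i => sub_pos.2 (hy.2 i).2
  have hcpow : ∀ r : ℝ, 0 < r → ∀ a : ℂ,
      (r : ℂ) ^ (a + γ - 1) = r * ((r : ℂ) ^ (a - 1) * (r : ℂ) ^ (γ - 1)) := fun r hr a => by
    have hr0 : (r : ℂ) ≠ 0 := Complex.ofReal_ne_zero.2 hr.ne'
    rw [show a + γ - 1 = 1 + (a - 1 + (γ - 1)) by ring, Complex.cpow_add _ _ hr0,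
      Complex.cpow_add _ _ hr0, Complex.cpow_one]
  have hmid : ∏ i, ((y i * (1 - y i) * nodeProd y i : ℝ) : ℂ) ^ (γ - 1) =
      (∏ i, ((y i : ℂ) ^ (γ - 1) * ((1 - y i : ℝ) : ℂ) ^ (γ - 1))) *
        ((diffProd y ^ 2 : ℝ) : ℂ) ^ (γ - 1) := by
    rw [← prod_nodeProd, ofReal_prod_cpow _ (fun i _ => hnode i), ← Finset.prod_mul_distrib]
    refine Finset.prod_congr rfl fun i _ => ?_
    rw [Complex.ofReal_mul, Complex.mul_cpow_ofReal_nonneg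
      (mul_pos (h0 i) (h1 i)).le (hnode i), Complex.ofReal_mul,
      Complex.mul_cpow_ofReal_nonneg (h0 i).le (h1 i).le]
  rw [prod_univ_endpointExponents α β γ
    (fun j z => (nodeProd (withEndpoints y) j : ℂ) ^ (z - 1)), nodeProd_withEndpoints_zero hy,
    nodeProd_withEndpoints_last hy, diffProd_withEndpoints]
  simp only [nodeProd_withEndpoints_mid hy]
  rw [hmid, selbergIntegrand_eq _ _ _ hy, ← sq_mul_cpow_sub_one (diffProd_pos hy.1), betaWeight,
    ofReal_prod_cpow _ (fun i _ => (h0 i).le), ofReal_prod_cpow _ (fun i _ => (h1 i).le)]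
  simp only [hcpow _ (h0 _), hcpow _ (h1 _), Finset.prod_mul_distrib, Complex.ofReal_mul,
    Complex.ofReal_prod]
  ring

lemma interlacingIntegrand_integral_fst {n : ℕ} {α β γ : ℂ} (hα : 0 < α.re) (hβ : 0 < β.re)
    (hγ : 0 < γ.re) {y : Fin n → ℝ} (hy : y ∈ orderedSimplex n) :
    ∫ x in interlacing (withEndpoints y), interlacingIntegrand α β γ (x, y) =
      Complex.Gamma α * Complex.Gamma β * Complex.Gamma γ ^ n / Complex.Gamma (α + β + n * γ) *
        selbergIntegrand n (α + γ) (β + γ) γ y := by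
  have hs : ∀ j, 0 < (endpointExponents n α β γ j).re := by
    refine Fin.cases hα (Fin.lastCases ?_ fun i => ?_) <;>
    simpa [endpointExponents, -Fin.succ_last]
  have hsum : ∑ j, endpointExponents n α β γ j = α + β + n * γ := by
    rw [Fin.sum_univ_succ, Fin.sum_univ_castSucc]
    simp [endpointExponents, -Fin.succ_last]
    ring
  obtain ⟨-, h2⟩ := dixon_anderson_integral hs (strictMono_withEndpoints hy)
  rw [setIntegral_congr_fun (isOpen_interlacing _).measurableSet fun x hx =>
      interlacingIntegrand_eq α β γ (mem_interlacing_withEndpoints_iff.1 ⟨hy, hx⟩).1,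
    integral_const_mul, h2, mul_left_comm, diffProd_mul_prod_nodeProd_withEndpoints α β γ hy, hsum,
    prod_univ_endpointExponents α β γ fun _ z => Complex.Gamma z, Finset.prod_const,
    Finset.card_univ, Fintype.card_fin]
  ring

lemma integrableOn_interlacingIntegrand {n : ℕ} {α β γ : ℂ} (hα : 0 < α.re) (hβ : 0 < β.re)
    (hγ : 0 < γ.re) :
    IntegrableOn (interlacingIntegrand α β γ) (interlacingPairs n) ∧
      ∫ p in interlacingPairs n, interlacingIntegrand α β γ p =
        ∫ x in orderedSimplex (n + 1), ∫ y in interlacing x,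
          interlacingIntegrand α β γ (x, y) := by
  refine integrableOn_and_setIntegral_sections (fun _ _ => Iff.rfl)
    (measurableSet_orderedSimplex _) (fun x _ => (isOpen_interlacing x).measurableSet)
    (measurableSet_interlacingPairs n) (measurable_interlacingIntegrand _ _ _).aestronglyMeasurable
    (fun x hx => (interlacingIntegrand_integral_snd α β hγ hx).1) ?_
  have hS : IntegrableOn (selbergIntegrand (n + 1) (α.re : ℂ) (β.re : ℂ) (γ.re : ℂ))
      (orderedSimplex (n + 1)) := by
    apply integrableOn_selbergIntegrand <;> simp only [Complex.ofReal_re] <;> positivity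
  have h : IntegrableOn
      (fun x => ((∫ y in interlacing x, ‖interlacingIntegrand α β γ (x, y)‖ : ℝ) : ℂ))
      (orderedSimplex (n + 1)) := by
    refine IntegrableOn.congr_fun (Integrable.const_mul hS (Complex.Gamma (γ.re : ℂ) ^ (n + 1) /
      Complex.Gamma ((n + 1) * (γ.re : ℂ)))) (fun x hx => ?_) (measurableSet_orderedSimplex _)
    rw [← integral_complex_ofReal, setIntegral_congr_fun (isOpen_interlacing x).measurableSet
      fun y hy => ofReal_norm_interlacingIntegrand α β γ hx hy]
    exact (interlacingIntegrand_integral_snd _ _ (by simpa) hx).2.symm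
  have := h.re
  rw [IntegrableOn]
  simpa only [RCLike.re_to_complex, Complex.ofReal_re] using this

/-- The Selberg integral over the ordered simplex. -/
noncomputable def selbergIntegral (n : ℕ) (α β γ : ℂ) : ℂ :=
  ∫ t in orderedSimplex n, selbergIntegrand n α β γ t

lemma selbergIntegral_zero (α β γ : ℂ) : selbergIntegral 0 α β γ = 1 := by
  have : orderedSimplex 0 = Set.univ :=
    Set.eq_univ_of_forall fun t => ⟨fun i => i.elim0, fun i => i.elim0⟩
  simp [selbergIntegral, selbergIntegrand, this, Measure.volume_pi_eq_dirac 0]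

lemma re_natCast_mul (m : ℕ) (γ : ℂ) : ((m : ℂ) * γ).re = m * γ.re := by
  rw [← Complex.ofReal_natCast, Complex.re_ofReal_mul]

lemma selbergIntegral_succ (n : ℕ) {α β γ : ℂ} (hα : 0 < α.re) (hβ : 0 < β.re) (hγ : 0 < γ.re) :
    selbergIntegral (n + 1) α β γ =
      Complex.Gamma α * Complex.Gamma β * Complex.Gamma ((n + 1) * γ) /
        (Complex.Gamma (α + β + n * γ) * Complex.Gamma γ) *
        selbergIntegral n (α + γ) (β + γ) γ := by
  obtain ⟨h1, h2⟩ := integrableOn_interlacingIntegrand (n := n) hα hβ hγ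
  rw [setIntegral_sections_symm (S := orderedSimplex n)
      (T := fun y => interlacing (withEndpoints y))
      (fun x y => mem_interlacing_withEndpoints_iff.symm) (measurableSet_orderedSimplex n)
      (fun y _ => (isOpen_interlacing _).measurableSet) (measurableSet_interlacingPairs n) h1,
    setIntegral_congr_fun (measurableSet_orderedSimplex _) fun y hy =>
      interlacingIntegrand_integral_fst hα hβ hγ hy,
    setIntegral_congr_fun (measurableSet_orderedSimplex _) fun x hx =>
      (interlacingIntegrand_integral_snd α β hγ hx).2,
    integral_const_mul, integral_const_mul, ← selbergIntegral, ← selbergIntegral] at h2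
  have hΓ := Complex.Gamma_ne_zero_of_re_pos hγ
  have hΓn : Complex.Gamma ((n + 1) * γ) ≠ 0 := by
    refine Complex.Gamma_ne_zero_of_re_pos ?_
    rw [← Nat.cast_add_one, re_natCast_mul]; positivity
  have hd : Complex.Gamma γ ^ (n + 1) / Complex.Gamma ((n + 1) * γ) ≠ 0 :=
    div_ne_zero (pow_ne_zero _ hΓ) hΓn
  refine mul_left_cancel₀ hd (h2.symm.trans ?_)
  generalize Complex.Gamma ((n + 1) * γ) = G at hΓn
  field_simp
  ring

lemma selbergIntegral_eq_of_re_pos (n : ℕ) {α β γ : ℂ} (hα : 0 < α.re) (hβ : 0 < β.re)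
    (hγ : 0 < γ.re) :
    selbergIntegral n α β γ = ∏ i ∈ Finset.range n,
      (Complex.Gamma (α + i * γ) * Complex.Gamma (β + i * γ) * Complex.Gamma ((i + 1) * γ)) /
        (Complex.Gamma (α + β + (i + n - 1) * γ) * Complex.Gamma γ) := by
  induction n generalizing α β with
  | zero => simp [selbergIntegral_zero]
  | succ n ih =>
    rw [selbergIntegral_succ n hα hβ hγ, ih (by simp; linarith) (by simp; linarith)]
    simp only [Finset.prod_div_distrib, Finset.prod_mul_distrib]
    rw [Finset.prod_range_succ' (fun i : ℕ => Complex.Gamma (α + i * γ)),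
      Finset.prod_range_succ' (fun i : ℕ => Complex.Gamma (β + i * γ)),
      Finset.prod_range_succ (fun i : ℕ => Complex.Gamma ((i + 1) * γ)),
      Finset.prod_range_succ' (fun i : ℕ =>
        Complex.Gamma (α + β + (i + ((n + 1 : ℕ) : ℂ) - 1) * γ))]
    have h1 : ∀ a : ℂ, ∏ i ∈ Finset.range n, Complex.Gamma (a + ((i + 1 : ℕ) : ℂ) * γ) =
        ∏ i ∈ Finset.range n, Complex.Gamma (a + γ + i * γ) := fun a =>
      Finset.prod_congr rfl fun i _ => by congr 1; push_cast; ring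
    have h2 : ∏ i ∈ Finset.range n,
          Complex.Gamma (α + β + (((i + 1 : ℕ) : ℂ) + ((n + 1 : ℕ) : ℂ) - 1) * γ) =
        ∏ i ∈ Finset.range n, Complex.Gamma (α + γ + (β + γ) + (i + n - 1) * γ) :=
      Finset.prod_congr rfl fun i _ => by congr 1; push_cast; ring
    have h3 : α + β + (((0 : ℕ) : ℂ) + ((n + 1 : ℕ) : ℂ) - 1) * γ = α + β + n * γ := by
      push_cast; ring
    rw [h1, h1, h2, h3]
    simp only [Finset.prod_const, Finset.card_range, Nat.cast_zero, zero_mul, add_zero, pow_succ]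
    rw [div_mul_div_comm]
    congr 1 <;> ring

/-- The real parts of the exponents `γ` for which the Selberg integral in `n + 1` variables
converges, when the other two exponents have real parts `a` and `b`. -/
def convergenceRange (n : ℕ) (a b : ℝ) : Set ℝ :=
  {c | 0 < 1 + (n + 1) * c ∧ 0 < a + n * c ∧ 0 < b + n * c}

lemma isOpen_convergenceRange (n : ℕ) (a b : ℝ) : IsOpen (convergenceRange n a b) := by
  have h : ∀ u v : ℝ, IsOpen {c | 0 < u + v * c} := fun u v =>
    isOpen_lt continuous_const (by fun_prop)
  exact (h _ _).inter ((h _ _).inter (h _ _))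

lemma mem_convergenceRange_of_le {n : ℕ} {a b c c' : ℝ} (hc : c ∈ convergenceRange n a b)
    (h : c ≤ c') : c' ∈ convergenceRange n a b := by
  have h1 : n * c ≤ n * c' := mul_le_mul_of_nonneg_left h n.cast_nonneg
  exact ⟨by linarith [hc.1], by linarith [hc.2.1], by linarith [hc.2.2]⟩

lemma convex_convergenceRange (n : ℕ) (a b : ℝ) : Convex ℝ (convergenceRange n a b) :=
  Set.OrdConnected.convex ⟨fun _ hx _ _ _ hz => mem_convergenceRange_of_le hx hz.1⟩

lemma hasDerivAt_selbergIntegrand {n : ℕ} (α β γ : ℂ) {t : Fin n → ℝ} (ht : t ∈ orderedSimplex n) :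
    HasDerivAt (fun γ => selbergIntegrand n α β γ t)
      (selbergIntegrand n α β γ t * (2 * Real.log (diffProd t) : ℝ)) γ := by
  have hP := diffProd_pos ht.1
  simp only [fun γ => selbergIntegrand_eq α β γ ht]
  have h1 : HasDerivAt (fun γ : ℂ => 2 * γ) 2 γ := by
    simpa using (hasDerivAt_id γ).const_mul (2 : ℂ)
  refine ((h1.const_cpow (c := (diffProd t : ℂ))
    (Or.inl (Complex.ofReal_ne_zero.2 hP.ne'))).const_mul (betaWeight α β t)).congr_deriv ?_
  rw [Complex.ofReal_mul, Complex.ofReal_log hP.le]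
  push_cast
  ring

lemma norm_selbergIntegrand_mul_log_le {n : ℕ} (α β : ℂ) {γ : ℂ} {c ε : ℝ} (hε : 0 < ε)
    (hc : c + ε ≤ γ.re) {t : Fin n → ℝ} (ht : t ∈ orderedSimplex n) :
    ‖selbergIntegrand n α β γ t * (2 * Real.log (diffProd t) : ℝ)‖ ≤
      1 / ε * ‖selbergIntegrand n α β (c : ℂ) t‖ := by
  have hP := diffProd_pos ht.1
  have hP1 := diffProd_le_one ht
  have hlog := (Real.abs_log_mul_self_rpow_lt _ (2 * ε) hP hP1 (by linarith)).le
  rw [abs_mul, abs_of_pos (Real.rpow_pos_of_pos hP _)] at hlog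
  have hW : 0 ≤ ∏ i, t i ^ (α.re - 1) * (1 - t i) ^ (β.re - 1) :=
    Finset.prod_nonneg fun i _ => by
      have := (ht.2 i).1
      have := sub_pos.2 (ht.2 i).2
      positivity
  have hpow : diffProd t ^ (2 * γ.re) ≤ diffProd t ^ (2 * c) * diffProd t ^ (2 * ε) := by
    rw [← Real.rpow_add hP]
    exact Real.rpow_le_rpow_of_exponent_ge hP hP1 (by linarith)
  rw [norm_mul, norm_selbergIntegrand α β γ ht, norm_selbergIntegrand α β _ ht, Complex.norm_real,
    Real.norm_eq_abs, abs_mul, abs_two, Complex.ofReal_re]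
  have hc0 : 0 ≤ diffProd t ^ (2 * c) := Real.rpow_nonneg hP.le _
  calc (∏ i, t i ^ (α.re - 1) * (1 - t i) ^ (β.re - 1)) * diffProd t ^ (2 * γ.re) *
        (2 * |Real.log (diffProd t)|)
      ≤ (∏ i, t i ^ (α.re - 1) * (1 - t i) ^ (β.re - 1)) *
        (diffProd t ^ (2 * c) * diffProd t ^ (2 * ε)) * (2 * |Real.log (diffProd t)|) := by gcongr
    _ = (∏ i, t i ^ (α.re - 1) * (1 - t i) ^ (β.re - 1)) * diffProd t ^ (2 * c) * 2 *
        (|Real.log (diffProd t)| * diffProd t ^ (2 * ε)) := by ring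
    _ ≤ (∏ i, t i ^ (α.re - 1) * (1 - t i) ^ (β.re - 1)) * diffProd t ^ (2 * c) * 2 *
        (1 / (2 * ε)) := by gcongr
    _ = _ := by field_simp

lemma differentiableAt_selbergIntegral {n : ℕ} {α β γ : ℂ} (hα : 0 < α.re) (hβ : 0 < β.re)
    (hγ : γ.re ∈ convergenceRange n α.re β.re) :
    DifferentiableAt ℂ (fun γ => selbergIntegral (n + 1) α β γ) γ := by
  obtain ⟨δ, hδ, hball⟩ := Metric.isOpen_iff.1 (isOpen_convergenceRange n α.re β.re) γ.re hγ
  set c := γ.re - δ / 2 with hc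
  have hcr : c ∈ convergenceRange n α.re β.re := hball (by
    rw [Metric.mem_ball, Real.dist_eq, hc, sub_sub_cancel_left, abs_neg, abs_of_pos] <;> linarith)
  have hmem : ∀ᵐ t ∂volume.restrict (orderedSimplex (n + 1)), t ∈ orderedSimplex (n + 1) :=
    ae_restrict_mem (measurableSet_orderedSimplex _)
  refine (hasDerivAt_integral_of_dominated_loc_of_deriv_le
    (F := fun γ t => selbergIntegrand (n + 1) α β γ t)
    (F' := fun γ t => selbergIntegrand (n + 1) α β γ t * (2 * Real.log (diffProd t) : ℝ))
    (bound := fun t => 1 / (δ / 4) * ‖selbergIntegrand (n + 1) α β (c : ℂ) t‖)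
    (Metric.ball_mem_nhds γ (by linarith : 0 < δ / 4))
    (Filter.Eventually.of_forall fun γ =>
      (measurable_selbergIntegrand _ α β γ).aestronglyMeasurable)
    (integrableOn_selbergIntegrand hα hβ hγ.1 hγ.2.1 hγ.2.2) ?_ ?_ ?_ ?_).2.differentiableAt
  · refine ((measurable_selbergIntegrand _ α β γ).mul ?_).aestronglyMeasurable
    unfold diffProd
    fun_prop
  · filter_upwards [hmem] with t ht z hz
    refine norm_selbergIntegrand_mul_log_le α β (by linarith) ?_ ht
    have := (Complex.abs_re_le_norm (z - γ)).trans_lt (mem_ball_iff_norm.1 hz)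
    rw [Complex.sub_re] at this
    linarith [(abs_lt.1 this).1]
  · exact (integrableOn_selbergIntegrand hα hβ (by simpa using hcr.1) (by simpa using hcr.2.1)
      (by simpa using hcr.2.2)).norm.const_mul _
  · filter_upwards [hmem] with t ht z _
    exact hasDerivAt_selbergIntegrand α β z ht

/-- The value of the Selberg integral, written without the removable singularity at `γ = 0`. -/
noncomputable def selbergProduct (n : ℕ) (α β γ : ℂ) : ℂ :=
  ∏ i ∈ Finset.range n,
    (Complex.Gamma (α + i * γ) * Complex.Gamma (β + i * γ) * Complex.Gamma (1 + (i + 1) * γ)) *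
      ((i + 1 : ℂ)⁻¹ * ((Complex.Gamma (α + β + (i + n - 1) * γ))⁻¹ * (Complex.Gamma (1 + γ))⁻¹))

lemma selbergProduct_eq (n : ℕ) (α β : ℂ) {γ : ℂ} (hγ : γ ≠ 0) :
    selbergProduct n α β γ = ∏ i ∈ Finset.range n,
      (Complex.Gamma (α + i * γ) * Complex.Gamma (β + i * γ) * Complex.Gamma ((i + 1) * γ)) /
        (Complex.Gamma (α + β + (i + n - 1) * γ) * Complex.Gamma γ) := by
  refine Finset.prod_congr rfl fun i _ => ?_
  have hi : (i + 1 : ℂ) ≠ 0 := Nat.cast_add_one_ne_zero i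
  rw [add_comm 1, add_comm 1, Complex.Gamma_add_one _ (mul_ne_zero hi hγ),
    Complex.Gamma_add_one _ hγ, mul_inv, div_eq_mul_inv, mul_inv]
  field_simp

lemma differentiableAt_Gamma_add_mul {a γ : ℂ} (m : ℕ) (h : 0 < a.re + m * γ.re) :
    DifferentiableAt ℂ (fun γ => Complex.Gamma (a + m * γ)) γ := by
  have h0 : 0 < (a + m * γ).re := by rwa [Complex.add_re, re_natCast_mul]
  have hΓ : DifferentiableAt ℂ Complex.Gamma (a + m * γ) :=
    Complex.differentiableAt_Gamma _ fun k hk => by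
      have : (0 : ℝ) ≤ k := k.cast_nonneg
      rw [hk, Complex.neg_re, Complex.natCast_re] at h0
      linarith
  exact hΓ.comp γ (by fun_prop)

lemma add_mul_pos_of_le {a c : ℝ} {i n : ℕ} (ha : 0 < a) (h : 0 < a + n * c) (hi : i ≤ n) :
    0 < a + i * c := by
  have hi' : (i : ℝ) ≤ n := Nat.cast_le.2 hi
  rcases le_total 0 c with hc | hc
  · positivity
  · nlinarith

lemma differentiableAt_selbergProduct {n : ℕ} {α β γ : ℂ} (hα : 0 < α.re) (hβ : 0 < β.re)
    (hγ : γ.re ∈ convergenceRange n α.re β.re) :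
    DifferentiableAt ℂ (fun γ => selbergProduct (n + 1) α β γ) γ := by
  unfold selbergProduct
  refine DifferentiableAt.fun_finsetProd fun i hi => ?_
  have hin : i ≤ n := Nat.lt_succ_iff.1 (Finset.mem_range.1 hi)
  have h1 := differentiableAt_Gamma_add_mul i (add_mul_pos_of_le hα hγ.2.1 hin)
  have h2 := differentiableAt_Gamma_add_mul i (add_mul_pos_of_le hβ hγ.2.2 hin)
  have h3 := differentiableAt_Gamma_add_mul (a := 1) (γ := γ) (i + 1)
    (add_mul_pos_of_le (n := n + 1) (by simp) (by simpa using hγ.1) (by lia))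
  push_cast at h3
  have h4 : DifferentiableAt ℂ
      (fun γ => (Complex.Gamma (α + β + (i + (n + 1 : ℕ) - 1) * γ))⁻¹) γ :=
    (Complex.differentiable_one_div_Gamma _).comp γ (by fun_prop)
  have h5 : DifferentiableAt ℂ (fun γ => (Complex.Gamma (1 + γ))⁻¹) γ :=
    (Complex.differentiable_one_div_Gamma _).comp γ (by fun_prop)
  exact ((h1.mul h2).mul h3).mul ((h4.mul h5).const_mul _)

theorem selbergIntegral_eq_selbergProduct {n : ℕ} {α β γ : ℂ} (hα : 0 < α.re) (hβ : 0 < β.re)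
    (hγ : γ.re ∈ convergenceRange n α.re β.re) :
    selbergIntegral (n + 1) α β γ = selbergProduct (n + 1) α β γ := by
  set U : Set ℂ := Complex.re ⁻¹' convergenceRange n α.re β.re
  have hU : IsOpen U := (isOpen_convergenceRange _ _ _).preimage Complex.continuous_re
  have hUc : IsPreconnected U :=
    ((convex_convergenceRange n α.re β.re).linear_preimage Complex.reLm).isPreconnected
  have h1 : (1 : ℂ) ∈ U := by
    refine ⟨?_, ?_, ?_⟩ <;> simp only [Complex.one_re] <;> positivity
  have hf : AnalyticOnNhd ℂ (fun γ => selbergIntegral (n + 1) α β γ) U :=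
    DifferentiableOn.analyticOnNhd (fun γ hγ =>
      (differentiableAt_selbergIntegral hα hβ hγ).differentiableWithinAt) hU
  have hg : AnalyticOnNhd ℂ (fun γ => selbergProduct (n + 1) α β γ) U :=
    DifferentiableOn.analyticOnNhd (fun γ hγ =>
      (differentiableAt_selbergProduct hα hβ hγ).differentiableWithinAt) hU
  refine hf.eqOn_of_preconnected_of_eventuallyEq hg hUc h1 ?_ hγ
  have hpos : {z : ℂ | 0 < z.re} ∈ nhds (1 : ℂ) :=
    (isOpen_lt continuous_const Complex.continuous_re).mem_nhds (by simp)
  filter_upwards [hpos] with z hz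
  rw [selbergIntegral_eq_of_re_pos _ hα hβ hz,
    selbergProduct_eq _ _ _ (fun h => by simp [h] at hz)]

/-- Selberg integral, ordered form. For `k ≥ 1` and complex `α, β, γ` with
`Re α > 0`, `Re β > 0`, `γ ≠ 0` and `Re γ > −min{1/k, Re α/(k−1), Re β/(k−1)}` (for `k = 1`
only `Re γ > −1` is required), the integral of the Selberg integrand over the ordered
simplex converges absolutely and equals
`∏_{i=0}^{k−1} Γ(α+iγ)Γ(β+iγ)Γ((i+1)γ) / (Γ(α+β+(i+k−1)γ)Γ(γ))`. -/
theorem selberg_integral_ordered (k : ℕ) (hk : 1 ≤ k) (α β γ : ℂ)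
    (hα : 0 < α.re) (hβ : 0 < β.re) (hγ0 : γ ≠ 0)
    (hγ1 : -(1 / (k : ℝ)) < γ.re)
    (hγ2 : 1 < k → -min (α.re / ((k : ℝ) - 1)) (β.re / ((k : ℝ) - 1)) < γ.re) :
    IntegrableOn (selbergIntegrand k α β γ) (orderedSimplex k) volume ∧
      ∫ t in orderedSimplex k, selbergIntegrand k α β γ t
        = ∏ i ∈ Finset.range k,
            (Complex.Gamma (α + (i : ℂ) * γ) * Complex.Gamma (β + (i : ℂ) * γ) *
              Complex.Gamma (((i : ℂ) + 1) * γ)) /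
            (Complex.Gamma (α + β + ((i : ℂ) + (k : ℂ) - 1) * γ) * Complex.Gamma γ) := by
  obtain ⟨n, rfl⟩ := Nat.exists_eq_succ_of_ne_zero (by lia : k ≠ 0)
  have hγ : γ.re ∈ convergenceRange n α.re β.re := by
    refine ⟨?_, ?_⟩
    · have hn : (0 : ℝ) < n + 1 := by positivity
      rw [Nat.cast_succ, neg_lt, lt_div_iff₀ hn] at hγ1
      linarith
    · rcases Nat.eq_zero_or_pos n with rfl | hn
      · simpa using ⟨hα, hβ⟩
      · have hn' : (0 : ℝ) < n := Nat.cast_pos.2 hn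
        have h := hγ2 (by lia)
        rw [Nat.cast_succ, add_sub_cancel_right, neg_lt, lt_min_iff, lt_div_iff₀ hn',
          lt_div_iff₀ hn'] at h
        exact ⟨by linarith [h.1], by linarith [h.2]⟩
  exact ⟨integrableOn_selbergIntegrand hα hβ hγ.1 hγ.2.1 hγ.2.2,
    (selbergIntegral_eq_selbergProduct hα hβ hγ).trans (selbergProduct_eq _ _ _ hγ0)⟩
end

section
/- Let k1, k2 ≥ 0 be integers and let β1, β2, γ be complex numbers with β1 + β2 = γ + 1. Assume that β2 + (i − k1 − 1)γ ∉ ℤ for all 1 ≤ i ≤ k1, and that none of the complex numbers β1 + iγ (0 ≤ i ≤ k1−1), β1 + (i − k2)γ (0 ≤ i ≤ k1−1), β2 + (i − k1)γ (0 ≤ i ≤ k2−1) and β2 + iγ (0 ≤ i ≤ k2−1) is a nonpositive integer. Then ∏_{i=1}^{k1} sin(π(β1 − (i − k1 + k2)γ)) / sin(π(β2 + (i − k1 − 1)γ)) = ∏_{i=0}^{k1−1} Γ(β1 + iγ)/Γ(β1 + (i − k2)γ) · ∏_{i=0}^{k2−1} Γ(β2 + (i − k1)γ)/Γ(β2 +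 iγ). -/
/-- The quotient form of Euler's reflection formula; it holds at the poles as well. -/
theorem Complex.sin_div_sin_eq_Gamma (a b : ℂ) :
    Complex.sin (Real.pi * a) / Complex.sin (Real.pi * b) =
      (Complex.Gamma b * Complex.Gamma (1 - b)) / (Complex.Gamma a * Complex.Gamma (1 - a)) := by
  have hpi : (Real.pi : ℂ) ≠ 0 := Complex.ofReal_ne_zero.2 Real.pi_ne_zero
  rw [Complex.Gamma_mul_Gamma_one_sub, Complex.Gamma_mul_Gamma_one_sub, div_div_div_eq,
    mul_comm (Complex.sin (Real.pi * b)), mul_div_mul_left _ _ hpi]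

theorem Finset.prod_range_div_shift_comm {F : Type*} [Field F] (f : ℕ → F) (m n : ℕ)
    (hf : ∀ i < m + n, f i ≠ 0) :
    ∏ i ∈ Finset.range m, f i / f (n + i) = ∏ i ∈ Finset.range n, f i / f (m + i) := by
  rw [Finset.prod_div_distrib, Finset.prod_div_distrib, div_eq_div_iff,
    ← Finset.prod_range_add, ← Finset.prod_range_add, add_comm]
  all_goals
    refine Finset.prod_ne_zero_iff.2 fun i hi => hf _ ?_
    have := Finset.mem_range.1 hi
    omega

/-- For integers `k1, k2 ≥ 0` and complex `β1, β2, γ` with `β1 + β2 = γ + 1`,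
assuming `β2 + (i − k1 − 1)γ ∉ ℤ` for `1 ≤ i ≤ k1` and that none of
`β1 + iγ` (`0 ≤ i ≤ k1−1`), `β1 + (i−k2)γ` (`0 ≤ i ≤ k1−1`), `β2 + (i−k1)γ` (`0 ≤ i ≤ k2−1`),
`β2 + iγ` (`0 ≤ i ≤ k2−1`) is a nonpositive integer, we have
`∏_{i=1}^{k1} sin(π(β1 − (i−k1+k2)γ)) / sin(π(β2 + (i−k1−1)γ))
  = ∏_{i=0}^{k1−1} Γ(β1+iγ)/Γ(β1+(i−k2)γ) · ∏_{i=0}^{k2−1} Γ(β2+(i−k1)γ)/Γ(β2+iγ)`. -/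
theorem sin_gamma_chain_symmetry (k1 k2 : ℕ) (β1 β2 γ : ℂ)
    (hββ : β1 + β2 = γ + 1)
    (hnotint : ∀ i : ℕ, 1 ≤ i → i ≤ k1 →
      ∀ m : ℤ, β2 + ((i : ℂ) - (k1 : ℂ) - 1) * γ ≠ (m : ℂ))
    (h1 : ∀ i : ℕ, i < k1 → ∀ m : ℤ, m ≤ 0 → β1 + (i : ℂ) * γ ≠ (m : ℂ))
    (h2 : ∀ i : ℕ, i < k1 → ∀ m : ℤ, m ≤ 0 → β1 + ((i : ℂ) - (k2 : ℂ)) * γ ≠ (m : ℂ))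
    (h3 : ∀ i : ℕ, i < k2 → ∀ m : ℤ, m ≤ 0 → β2 + ((i : ℂ) - (k1 : ℂ)) * γ ≠ (m : ℂ))
    (h4 : ∀ i : ℕ, i < k2 → ∀ m : ℤ, m ≤ 0 → β2 + (i : ℂ) * γ ≠ (m : ℂ)) :
    ∏ i ∈ Finset.range k1,
        Complex.sin ((Real.pi : ℂ) * (β1 - (((i : ℂ) + 1) - (k1 : ℂ) + (k2 : ℂ)) * γ)) /
          Complex.sin ((Real.pi : ℂ) * (β2 + (((i : ℂ) + 1) - (k1 : ℂ) - 1) * γ))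
      = (∏ i ∈ Finset.range k1,
            Complex.Gamma (β1 + (i : ℂ) * γ) / Complex.Gamma (β1 + ((i : ℂ) - (k2 : ℂ)) * γ)) *
        ∏ i ∈ Finset.range k2,
            Complex.Gamma (β2 + ((i : ℂ) - (k1 : ℂ)) * γ) / Complex.Gamma (β2 + (i : ℂ) * γ) := by
  have hf : ∀ i < k1 + k2, Complex.Gamma (β2 + ((i : ℂ) - (k1 : ℂ)) * γ) ≠ 0 := by
    intro i hi
    refine Complex.Gamma_ne_zero fun m hm => ?_
    rcases lt_or_ge i k1 with h | h
    · refine hnotint (i + 1) (by omega) (by omega) (-m) ?_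
      push_cast
      rw [← hm]
      ring
    · obtain ⟨j, rfl⟩ := Nat.exists_eq_add_of_le h
      refine h4 j (by omega) (-m) (by omega) ?_
      push_cast at hm ⊢
      rw [← hm]
      ring
  have hshift := Finset.prod_range_div_shift_comm _ k1 k2 hf
  have hterm : ∀ i ∈ Finset.range k1,
      Complex.sin ((Real.pi : ℂ) * (β1 - (((i : ℂ) + 1) - (k1 : ℂ) + (k2 : ℂ)) * γ)) /
          Complex.sin ((Real.pi : ℂ) * (β2 + (((i : ℂ) + 1) - (k1 : ℂ) - 1) * γ)) =
        Complex.Gamma (β1 + ((k1 - 1 - i : ℕ) : ℂ) * γ) /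
            Complex.Gamma (β1 + (((k1 - 1 - i : ℕ) : ℂ) - (k2 : ℂ)) * γ) *
          (Complex.Gamma (β2 + ((i : ℂ) - (k1 : ℂ)) * γ) /
            Complex.Gamma (β2 + (((k2 + i : ℕ) : ℂ) - (k1 : ℂ)) * γ)) := by
    intro i hi
    have hcast : ((k1 - 1 - i : ℕ) : ℂ) = (k1 : ℂ) - 1 - i := by
      have := Finset.mem_range.1 hi
      rw [Nat.cast_sub (by omega), Nat.cast_sub (by omega), Nat.cast_one]
    obtain rfl : β1 = γ + 1 - β2 := eq_sub_of_add_eq hββ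
    rw [Complex.sin_div_sin_eq_Gamma, hcast, div_mul_div_comm,
      mul_comm (Complex.Gamma (β2 + _))]
    push_cast
    congr 3 <;> ring_nf
  rw [Finset.prod_congr rfl hterm, Finset.prod_mul_distrib, hshift,
    Finset.prod_range_reflect (fun i : ℕ =>
      Complex.Gamma (β1 + (i : ℂ) * γ) / Complex.Gamma (β1 + ((i : ℂ) - (k2 : ℂ)) * γ))]
  simp only [Nat.cast_add, add_sub_cancel_left]
end

section
/- Let k1, k2 ≥ 0 be integers and let a = (a_1,…,a_{k1}) be a weakly increasing sequence of integers with 0 ≤ a_1 ≤ … ≤ a_{k1} ≤ k2. Define b = (b_1,…,b_{k2}) by b_j := #{ i ∈ {1,…,k1} : a_i < j } for 1 ≤ j ≤ k2 (so b is the conjugate–complement of a). Then for all complex numbers β and γ, ∏_{i=1}^{k2} sin(π(β + (i − b_i + k1 − k2 − 1)γ)) · ∏_{i=1}^{k1} sin(π(β − (i − k1 + k2)γ)) = ∏_{i=1}^{k1} sin(π(β − (i − a_i − k1 + k2)γ)) · ∏_{i=1}^{k2} sin(π(β + (i − k2 − 1)γ)). -/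
theorem Fin.sum_ite_le_sub {A : Type*} [AddCommGroup A] (g : ℕ → A) {b n : ℕ} (h : b ≤ n) :
    ∑ i : Fin n, (if b ≤ (i : ℕ) then g (i + 1) - g i else 0) = g n - g b := by
  induction n with
  | zero =>
    obtain rfl : b = 0 := by omega
    simp
  | succ n ih =>
    rw [Fin.sum_univ_castSucc]
    simp only [Fin.val_castSucc, Fin.val_last]
    rcases Nat.lt_or_ge n b with hb | hb
    · obtain rfl : b = n + 1 := by omega
      rw [if_neg (by omega), Finset.sum_eq_zero (fun i _ => if_neg (by omega))]
      simp
    · rw [ih hb, if_pos hb]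
      abel

theorem Fin.sum_ite_lt_sub {A : Type*} [AddCommGroup A] (g : ℕ → A) {a n : ℕ} (h : a ≤ n) :
    ∑ j : Fin n, (if (j : ℕ) < a then g (j + 1) - g j else 0) = g a - g 0 := by
  rw [← sub_sub_sub_cancel_left (g 0) (g a) (g n), ← Fin.sum_ite_le_sub g (Nat.zero_le n),
    ← Fin.sum_ite_le_sub g h, ← Finset.sum_sub_distrib]
  refine Finset.sum_congr rfl fun j _ => ?_
  by_cases hj : (j : ℕ) < a
  · simp [hj, not_le.mpr hj]
  · simp [hj, not_lt.mp hj]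

theorem card_filter_lt_le_iff {k : ℕ} {a : Fin k → ℕ} (ha : Monotone a) (c : ℕ) (i : Fin k) :
    (Finset.univ.filter (fun l => a l < c)).card ≤ i ↔ c ≤ a i := by
  refine ⟨fun h => ?_, fun h => ?_⟩
  · by_contra! hc
    have hsub : Finset.Iic i ⊆ Finset.univ.filter (fun l => a l < c) := fun l hl => by
      simpa using (ha (Finset.mem_Iic.mp hl)).trans_lt hc
    have := Finset.card_le_card hsub
    rw [Fin.card_Iic] at this
    omega
  · have hsub : Finset.univ.filter (fun l => a l < c) ⊆ Finset.Iio i := fun l hl => by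
      rw [Finset.mem_Iio]
      by_contra! hil
      exact absurd (Finset.mem_filter.mp hl).2 (not_lt.mpr (h.trans (ha hil)))
    simpa using Finset.card_le_card hsub

/-- Both sides of the difference count the cells `(i, j)` with `j < a i`, weighted by
`f (j - i) - f (j - i - 1)`, once by columns and once by rows. -/
theorem sum_conjugate_complement {A : Type*} [AddCommGroup A] (f : ℤ → A) {k1 k2 : ℕ}
    {a : Fin k1 → ℕ} (ha_mono : Monotone a) (ha_le : ∀ i, a i ≤ k2) {b : Fin k2 → ℕ}
    (hb : ∀ j : Fin k2,
      b j = (Finset.univ.filter (fun i : Fin k1 => a i < (j : ℕ) + 1)).card) :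
    ∑ j : Fin k2, f (j - b j) + ∑ i : Fin k1, f (-i - 1) =
      ∑ i : Fin k1, f (a i - i - 1) + ∑ j : Fin k2, f (j - k1) := by
  have hrow : ∀ i : Fin k1, f (a i - i - 1) - f (-i - 1) =
      ∑ j : Fin k2, if (j : ℕ) < a i then f (j - i) - f (j - i - 1) else 0 := fun i => by
    have h := Fin.sum_ite_lt_sub (fun n : ℕ => f (n - i - 1)) (ha_le i)
    simp only [Nat.cast_zero, zero_sub] at h
    rw [← h]
    refine Finset.sum_congr rfl fun j _ => ?_
    congr 3
    push_cast
    ring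
  have hcol : ∀ j : Fin k2, f (j - b j) - f (j - k1) =
      ∑ i : Fin k1, if (j : ℕ) < a i then f (j - i) - f (j - i - 1) else 0 := fun j => by
    have hbk : b j ≤ k1 := by
      rw [hb]
      exact (Finset.card_le_univ _).trans_eq (Fintype.card_fin k1)
    have h := Fin.sum_ite_le_sub (fun n : ℕ => -f (j - n)) hbk
    rw [neg_sub_neg] at h
    rw [← h]
    refine Finset.sum_congr rfl fun i _ => ?_
    have hiff : b j ≤ i ↔ (j : ℕ) < a i := by
      rw [hb, card_filter_lt_le_iff ha_mono, Nat.succ_le_iff]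
    simp only [hiff, neg_sub_neg, Nat.cast_add, Nat.cast_one, sub_sub]
  have key : ∑ j : Fin k2, (f (j - b j) - f (j - k1)) =
      ∑ i : Fin k1, (f (a i - i - 1) - f (-i - 1)) := by
    simp only [hrow, hcol]
    exact Finset.sum_comm
  rw [Finset.sum_sub_distrib, Finset.sum_sub_distrib] at key
  rw [← sub_eq_sub_iff_add_eq_add]
  exact key

theorem prod_conjugate_complement {M : Type*} [CommMonoid M] (f : ℤ → M) {k1 k2 : ℕ}
    {a : Fin k1 → ℕ} (ha_mono : Monotone a) (ha_le : ∀ i, a i ≤ k2) {b : Fin k2 → ℕ}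
    (hb : ∀ j : Fin k2,
      b j = (Finset.univ.filter (fun i : Fin k1 => a i < (j : ℕ) + 1)).card) :
    (∏ j : Fin k2, f (j - b j)) * ∏ i : Fin k1, f (-i - 1) =
      (∏ i : Fin k1, f (a i - i - 1)) * ∏ j : Fin k2, f (j - k1) := by
  have hms : ∑ j : Fin k2, ({(j - b j : ℤ)} : Multiset ℤ) + ∑ i : Fin k1, {(-i - 1 : ℤ)} =
      ∑ i : Fin k1, {(a i - i - 1 : ℤ)} + ∑ j : Fin k2, {(j - k1 : ℤ)} := by
    ext c
    have h := sum_conjugate_complement (fun n => (Multiset.count c {n} : ℤ)) ha_mono ha_le hb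
    simp only [Multiset.count_add, Multiset.count_sum']
    exact_mod_cast h
  have h := congrArg (fun s => (Multiset.map f s).prod) hms
  have hprod : ∀ {n : ℕ} (e : Fin n → ℤ),
      (Multiset.map f (∑ i, ({e i} : Multiset ℤ))).prod = ∏ i, f (e i) := fun e => by
    rw [← Multiset.coe_mapAddMonoidHom, map_sum, Multiset.prod_sum]
    simp
  simpa only [Multiset.map_add, Multiset.prod_add, hprod] using h

/-- Let `a = (a_1,…,a_{k1})` be weakly increasing with `0 ≤ a_i ≤ k2` and let
`b_j := #{i : a_i < j}` be its conjugate–complement. Then for all complex `β, γ`,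
`∏_{i=1}^{k2} sin(π(β+(i−b_i+k1−k2−1)γ)) · ∏_{i=1}^{k1} sin(π(β−(i−k1+k2)γ))
  = ∏_{i=1}^{k1} sin(π(β−(i−a_i−k1+k2)γ)) · ∏_{i=1}^{k2} sin(π(β+(i−k2−1)γ))`. -/
theorem sin_weight_conjugate_complement (k1 k2 : ℕ) (a : Fin k1 → ℕ)
    (ha_mono : Monotone a) (ha_le : ∀ i, a i ≤ k2)
    (b : Fin k2 → ℕ)
    (hb : ∀ j : Fin k2, b j = (Finset.univ.filter (fun i : Fin k1 => a i < (j : ℕ) + 1)).card)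
    (β γ : ℂ) :
    (∏ j : Fin k2,
        Complex.sin ((Real.pi : ℂ) *
          (β + (((j : ℕ) : ℂ) + 1 - ((b j : ℕ) : ℂ) + (k1 : ℂ) - (k2 : ℂ) - 1) * γ))) *
      ∏ i : Fin k1,
        Complex.sin ((Real.pi : ℂ) *
          (β - (((i : ℕ) : ℂ) + 1 - (k1 : ℂ) + (k2 : ℂ)) * γ))
    = (∏ i : Fin k1,
        Complex.sin ((Real.pi : ℂ) *
          (β - (((i : ℕ) : ℂ) + 1 - ((a i : ℕ) : ℂ) - (k1 : ℂ) + (k2 : ℂ)) * γ))) *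
      ∏ j : Fin k2,
        Complex.sin ((Real.pi : ℂ) *
          (β + (((j : ℕ) : ℂ) + 1 - (k2 : ℂ) - 1) * γ)) := by
  have h := prod_conjugate_complement
    (fun n : ℤ => Complex.sin ((Real.pi : ℂ) * (β + ((n : ℂ) + k1 - k2) * γ))) ha_mono ha_le hb
  convert h using 2 <;> refine Finset.prod_congr rfl fun i _ => ?_ <;> congr 2 <;>
    push_cast <;> ring
end
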